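/- Let α ∈ ℝ, s > 1/2, and let u ∈ C^∞(ℝ; H^s₊(S¹)) solve the α-Szegő equation i∂ₜu = Π(|u|²u) + α(u|1). Then for every bounded Borel function f on ℝ, the quantity L_f(u(t)) := (f(K_{u(t)}²) u(t) | u(t)) − α (f(K_{u(t)}²) 1 | 1), where f(K_{u(t)}²) is defined by the Borel functional calculus of the bounded positive self-adjoint operator K_{u(t)}², is independent of t. -/

import Mathlib

open Complex Filter
open scoped ComplexConjugate Topology ENNReal

noncomputable section

/-- ℓ²(ℕ, ℂ): the sequence model of the Hardy space L²₊(S¹), identifying a function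
with its sequence of nonnegative Fourier coefficients. -/
abbrev Hardy : Type := lp (fun _ : ℕ => ℂ) 2

/-- A coefficient sequence belongs to L²₊. -/
def MemL2 (u : ℕ → ℂ) : Prop := Memℓp u 2

/-- A coefficient sequence belongs to the Sobolev space H^s₊. -/
def MemHs (s : ℝ) (u : ℕ → ℂ) : Prop :=
  Summable fun n : ℕ => ((1 : ℝ) + (n : ℝ) ^ 2) ^ s * ‖u n‖ ^ 2

/-- The squared H^s norm of a coefficient sequence. -/
def hsNormSq (s : ℝ) (u : ℕ → ℂ) : ℝ :=
  ∑' n : ℕ, ((1 : ℝ) + (n : ℝ) ^ 2) ^ s * ‖u n‖ ^ 2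

/-- The L² inner product (f|g), ℂ-linear in the first argument. -/
def hinner (f g : ℕ → ℂ) : ℂ := ∑' n : ℕ, f n * conj (g n)

/-- The squared L² norm. -/
def l2normSq (f : ℕ → ℂ) : ℝ := ∑' n : ℕ, ‖f n‖ ^ 2

/-- Coefficients of the constant function 1. -/
def oneSeq : ℕ → ℂ := fun n => if n = 0 then 1 else 0

/-- The Hankel operator H_u(h) = Π(u ⬝ conj h) in Fourier coefficients. -/
def hankel (u h : ℕ → ℂ) : ℕ → ℂ := fun k => ∑' ℓ : ℕ, u (k + ℓ) * conj (h ℓ)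

/-- The shifted Hankel operator K_u = T_z^* ∘ H_u in Fourier coefficients. -/
def khankel (u h : ℕ → ℂ) : ℕ → ℂ := fun k => ∑' ℓ : ℕ, u (k + 1 + ℓ) * conj (h ℓ)

/-- H_u². -/
def hu2 (u h : ℕ → ℂ) : ℕ → ℂ := hankel u (hankel u h)

/-- K_u². -/
def ku2 (u h : ℕ → ℂ) : ℕ → ℂ := khankel u (khankel u h)

/-- The m-th Fourier coefficient of |u|², m ∈ ℤ. -/
def absSqCoeff (u : ℕ → ℂ) (m : ℤ) : ℂ :=
  ∑' q : ℕ × ℕ, if ((q.1 : ℤ) - (q.2 : ℤ) = m) then u q.1 * conj (u q.2) else 0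

/-- The Toeplitz operator T_{|u|²} in Fourier coefficients. -/
def toeplitzAbsSq (u h : ℕ → ℂ) : ℕ → ℂ :=
  fun k => ∑' ℓ : ℕ, absSqCoeff u ((k : ℤ) - (ℓ : ℤ)) * h ℓ

/-- Fourier coefficients of Π(|u|²u). -/
def cubic (u : ℕ → ℂ) : ℕ → ℂ := fun n =>
  ∑' q : ℕ × ℕ × ℕ, if q.1 + q.2.2 = q.2.1 + n then u q.1 * conj (u q.2.1) * u q.2.2 else 0

/-- `u : ℝ → (ℕ → ℂ)` solves the α-Szegő equation i ∂ₜ u = Π(|u|²u) + α(u|1),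
written coefficientwise on nonnegative Fourier modes. -/
def SolvesSzego (α : ℝ) (u : ℝ → ℕ → ℂ) : Prop :=
  ∀ n t, HasDerivAt (fun τ => u τ n)
    (-Complex.I * (cubic (u t) n + (α : ℂ) * u t 0 * oneSeq n)) t

/-- `u` is a smooth curve valued in H^s₊. -/
def SmoothHsCurve (s : ℝ) (u : ℝ → ℕ → ℂ) : Prop :=
  (∀ t, MemHs s (u t)) ∧ ∀ n, ContDiff ℝ (⊤ : ℕ∞) fun t => u t n

/-- `u` is a continuous curve valued in H^s₊. -/
def ContHsCurve (s : ℝ) (u : ℝ → ℕ → ℂ) : Prop :=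
  (∀ t, MemHs s (u t)) ∧
    ∀ t₀ : ℝ, Tendsto (fun t => hsNormSq s (fun n => u t n - u t₀ n)) (𝓝 t₀) (𝓝 0)

/-- E_u(τ) = ker(H_u² − τ² I) as a subset of ℓ². -/
def Espace (u : ℕ → ℂ) (τ : ℝ) : Set (ℕ → ℂ) :=
  {h | MemL2 h ∧ hu2 u h = ((τ : ℂ) ^ 2) • h}

/-- F_u(τ) = ker(K_u² − τ² I) as a subset of ℓ². -/
def Fspace (u : ℕ → ℂ) (τ : ℝ) : Set (ℕ → ℂ) :=
  {h | MemL2 h ∧ ku2 u h = ((τ : ℂ) ^ 2) • h}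

/-- Σ_H(u): τ > 0 such that E_u(τ) is not orthogonal to u. -/
def SigmaH (u : ℕ → ℂ) : Set ℝ :=
  {τ : ℝ | 0 < τ ∧ ∃ v ∈ Espace u τ, hinner u v ≠ 0}

/-- Σ_K(u): τ ≥ 0 such that F_u(τ) is not orthogonal to u. -/
def SigmaK (u : ℕ → ℂ) : Set ℝ :=
  {τ : ℝ | 0 ≤ τ ∧ ∃ v ∈ Fspace u τ, hinner u v ≠ 0}

/-- `p` is the orthogonal projection of `w` on the subspace `V` of ℓ². -/
def IsOrthProj (V : Set (ℕ → ℂ)) (w p : ℕ → ℂ) : Prop :=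
  p ∈ V ∧ ∀ v ∈ V, hinner (w - p) v = 0

/-- The rank of the shifted Hankel operator K_u. -/
def kuRank (u : ℕ → ℂ) : Cardinal :=
  Module.rank ℂ (Submodule.span ℂ (khankel u '' {h | MemL2 h}))

/-- The rank of the Hankel operator H_u. -/
def huRank (u : ℕ → ℂ) : Cardinal :=
  Module.rank ℂ (Submodule.span ℂ (hankel u '' {h | MemL2 h}))

/-- ℒ(N) : rank K_u = N. -/
def InLN (N : ℕ) (u : ℕ → ℂ) : Prop := MemL2 u ∧ kuRank u = N

/-- The constant function 1 as an element of ℓ². -/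
def oneH : Hardy := lp.single 2 0 1

/-- Schur-type bound for a pair of indices linked by `a + c = b + n` with `b`, `c` fixed. -/
theorem ENNReal.tsum_tsum_add_eq_add_le (f : ℕ → ℝ≥0∞) (b c : ℕ) :
    ∑' a, ∑' n, (if a + c = b + n then f a * f n else 0) ≤ 2 * ∑' n, f n ^ 2 := by
  have key : ∀ x y : ℝ≥0∞, x * y ≤ x ^ 2 + y ^ 2 := by
    intro x y
    rcases le_total x y with h | h
    · exact le_add_left (by rw [sq]; gcongr)
    · exact le_add_right (by rw [sq]; gcongr)
  have h1 : ∀ a, ∑' n, (if a + c = b + n then f a ^ 2 else 0) ≤ f a ^ 2 := by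
    intro a
    calc ∑' n, (if a + c = b + n then f a ^ 2 else 0)
        ≤ ∑' n, (if n = a + c - b then f a ^ 2 else 0) := by
          refine ENNReal.tsum_le_tsum fun n => ?_
          split_ifs <;> first | exact le_rfl | omega | simp
      _ = f a ^ 2 := tsum_ite_eq _ _
  have h2 : ∀ n, ∑' a, (if a + c = b + n then f n ^ 2 else 0) ≤ f n ^ 2 := by
    intro n
    calc ∑' a, (if a + c = b + n then f n ^ 2 else 0)
        ≤ ∑' a, (if a = b + n - c then f n ^ 2 else 0) := by
          refine ENNReal.tsum_le_tsum fun a => ?_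
          split_ifs <;> first | exact le_rfl | omega | simp
      _ = f n ^ 2 := tsum_ite_eq _ _
  calc ∑' a, ∑' n, (if a + c = b + n then f a * f n else 0)
      ≤ ∑' a, ∑' n, ((if a + c = b + n then f a ^ 2 else 0)
          + (if a + c = b + n then f n ^ 2 else 0)) := by
        refine ENNReal.tsum_le_tsum fun a => ENNReal.tsum_le_tsum fun n => ?_
        split_ifs
        · exact key _ _
        · simp
    _ = ∑' a, ∑' n, (if a + c = b + n then f a ^ 2 else 0)
          + ∑' n, ∑' a, (if a + c = b + n then f n ^ 2 else 0) := by
        simp_rw [ENNReal.tsum_add]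
        congr 1
        exact ENNReal.tsum_comm
    _ ≤ ∑' a, f a ^ 2 + ∑' n, f n ^ 2 :=
        add_le_add (ENNReal.tsum_le_tsum h1) (ENNReal.tsum_le_tsum h2)
    _ = 2 * ∑' n, f n ^ 2 := by rw [two_mul]

theorem ENNReal.tsum_quad_le (p x : ℕ → ℝ≥0∞)
    (hp : ∀ a b c n, a + c = b + n → p n ≤ p a + p c) :
    ∑' b, ∑' c, ∑' a, ∑' n,
        (if a + c = b + n then p n ^ 2 * (x a * x b * x c * x n) else 0)
      ≤ 4 * (∑' n, x n) ^ 2 * ∑' n, (p n * x n) ^ 2 := by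
  set y := ∑' n, (p n * x n) ^ 2
  have hI : ∑' b, ∑' c, ∑' a, ∑' n,
      (if a + c = b + n then (x b * x c) * ((p a * x a) * (p n * x n)) else 0)
      ≤ 2 * (∑' n, x n) ^ 2 * y := by
    calc _ = ∑' b, ∑' c, (x b * x c) * ∑' a, ∑' n,
          (if a + c = b + n then (p a * x a) * (p n * x n) else 0) := by
          simp_rw [← ENNReal.tsum_mul_left, mul_ite, mul_zero]
      _ ≤ ∑' b, ∑' c, (x b * x c) * (2 * y) := by
          gcongr
          exact ENNReal.tsum_tsum_add_eq_add_le (fun n => p n * x n) _ _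
      _ = 2 * (∑' n, x n) ^ 2 * y := by
          simp_rw [ENNReal.tsum_mul_right, ENNReal.tsum_mul_left, ENNReal.tsum_mul_right]
          ring
  calc _ ≤ ∑' b, ∑' c, ∑' a, ∑' n,
      ((if a + c = b + n then (x b * x c) * ((p a * x a) * (p n * x n)) else 0)
      + (if c + a = b + n then (x b * x a) * ((p c * x c) * (p n * x n)) else 0)) := by
        refine ENNReal.tsum_le_tsum fun b => ENNReal.tsum_le_tsum fun c =>
          ENNReal.tsum_le_tsum fun a => ENNReal.tsum_le_tsum fun n => ?_
        by_cases h : a + c = b + n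
        · rw [if_pos h, if_pos h, if_pos (by omega)]
          calc p n ^ 2 * (x a * x b * x c * x n)
              = p n * (p n * (x a * x b * x c * x n)) := by ring
            _ ≤ (p a + p c) * (p n * (x a * x b * x c * x n)) := by
                gcongr
                exact hp a b c n h
            _ = _ := by ring
        · rw [if_neg h]; exact zero_le
    _ = ∑' b, ∑' c, ∑' a, ∑' n,
          (if a + c = b + n then (x b * x c) * ((p a * x a) * (p n * x n)) else 0)
        + ∑' b, ∑' a, ∑' c, ∑' n,
          (if c + a = b + n then (x b * x a) * ((p c * x c) * (p n * x n)) else 0) := by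
        simp_rw [ENNReal.tsum_add]
        congr 1
        exact tsum_congr fun b => ENNReal.tsum_comm
    _ ≤ 2 * (∑' n, x n) ^ 2 * y + 2 * (∑' n, x n) ^ 2 * y := add_le_add hI hI
    _ = 4 * (∑' n, x n) ^ 2 * y := by ring

theorem ENNReal.tsum_cubic_le (q x : ℕ → ℝ≥0∞)
    (hq : ∀ a b c n, a + c = b + n → q n ≤ q a + q c) :
    ∑' b, ∑' c, ∑' a, ∑' n,
        (if a + c = b + n then q n * (x a * x b * x c) else 0)
      ≤ 2 * (∑' n, x n) ^ 2 * ∑' n, q n * x n := by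
  calc _ ≤ ∑' b, ∑' c, ∑' a, (x b * ((q a * x a) * x c) + x b * (x a * (q c * x c))) := by
        refine ENNReal.tsum_le_tsum fun b => ENNReal.tsum_le_tsum fun c =>
          ENNReal.tsum_le_tsum fun a => ?_
        calc _ ≤ ∑' n, (if n = a + c - b then
              (x b * ((q a * x a) * x c) + x b * (x a * (q c * x c))) else 0) := by
              refine ENNReal.tsum_le_tsum fun n => ?_
              by_cases h : a + c = b + n
              · rw [if_pos h, if_pos (by omega)]
                calc q n * (x a * x b * x c) ≤ (q a + q c) * (x a * x b * x c) := by
                      gcongr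
                      exact hq a b c n h
                  _ = _ := by ring
              · rw [if_neg h]; exact zero_le
          _ = _ := tsum_ite_eq _ _
    _ = 2 * (∑' n, x n) ^ 2 * ∑' n, q n * x n := by
        simp only [ENNReal.tsum_add, ENNReal.tsum_mul_left, ENNReal.tsum_mul_right]
        ring

theorem summable_and_tsum_le_of_ennreal {ι : Type*} {f : ι → ℝ} {C : ℝ} (hf : ∀ i, 0 ≤ f i)
    (hC : 0 ≤ C) (h : ∑' i, ENNReal.ofReal (f i) ≤ ENNReal.ofReal C) :
    Summable f ∧ ∑' i, f i ≤ C := by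
  have key : ∀ s : Finset ι, ∑ i ∈ s, f i ≤ C := by
    intro s
    rw [← ENNReal.ofReal_le_ofReal_iff hC, ENNReal.ofReal_sum_of_nonneg fun i _ => hf i]
    exact (ENNReal.sum_le_tsum s).trans h
  exact ⟨summable_of_sum_le hf key, Real.tsum_le_of_sum_le hf key⟩

theorem ENNReal.tsum_comm_quad (F : ℕ → ℕ → ℕ → ℕ → ℝ≥0∞) :
    ∑' n, ∑' a, ∑' b, ∑' c, F n a b c = ∑' b, ∑' c, ∑' a, ∑' n, F n a b c := by
  calc _ = ∑' n, ∑' b, ∑' a, ∑' c, F n a b c := tsum_congr fun n => ENNReal.tsum_comm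
    _ = ∑' b, ∑' n, ∑' a, ∑' c, F n a b c := ENNReal.tsum_comm
    _ = ∑' b, ∑' n, ∑' c, ∑' a, F n a b c :=
        tsum_congr fun b => tsum_congr fun n => ENNReal.tsum_comm
    _ = ∑' b, ∑' c, ∑' n, ∑' a, F n a b c := tsum_congr fun b => ENNReal.tsum_comm
    _ = _ := tsum_congr fun b => tsum_congr fun c => ENNReal.tsum_comm

theorem tsum_enorm_eq_ofReal {E : Type*} [NormedAddCommGroup E] {u : ℕ → E}
    (h : Summable fun n => ‖u n‖) : ∑' n, ‖u n‖ₑ = ENNReal.ofReal (∑' n, ‖u n‖) := by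
  rw [ENNReal.ofReal_tsum_of_nonneg (fun n => norm_nonneg _) h]
  simp

theorem enorm_cubic_le (u : ℕ → ℂ) (n : ℕ) :
    ‖cubic u n‖ₑ ≤ ∑' a, ∑' b, ∑' c,
      (if a + c = b + n then ‖u a‖ₑ * ‖u b‖ₑ * ‖u c‖ₑ else 0) := by
  unfold cubic
  refine enorm_tsum_le_tsum_enorm.trans (le_of_eq ?_)
  rw [ENNReal.tsum_prod']
  refine tsum_congr fun a => ?_
  rw [ENNReal.tsum_prod']
  refine tsum_congr fun b => tsum_congr fun c => ?_
  split_ifs <;> simp [enorm_mul]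

section Weights

variable {p : ℕ → ℝ} {u : ℕ → ℂ}

theorem ofReal_weight_add_le (hp0 : ∀ n, 0 ≤ p n)
    (hp : ∀ a b c n, a + c = b + n → p n ≤ p a + p c) (a b c n : ℕ) (h : a + c = b + n) :
    ENNReal.ofReal (p n) ≤ ENNReal.ofReal (p a) + ENNReal.ofReal (p c) := by
  rw [← ENNReal.ofReal_add (hp0 a) (hp0 c)]
  exact ENNReal.ofReal_le_ofReal (hp a b c n h)

theorem tsum_weight_sq (hp0 : ∀ n, 0 ≤ p n)
    (h2 : Summable fun n => p n ^ 2 * ‖u n‖ ^ 2) :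
    ∑' n, (ENNReal.ofReal (p n) * ‖u n‖ₑ) ^ 2 = ENNReal.ofReal (∑' n, p n ^ 2 * ‖u n‖ ^ 2) := by
  rw [ENNReal.ofReal_tsum_of_nonneg (fun n => by positivity) h2]
  refine tsum_congr fun n => ?_
  rw [ENNReal.ofReal_mul (by positivity), ENNReal.ofReal_pow (hp0 n), mul_pow,
    ENNReal.ofReal_pow (norm_nonneg _), ofReal_norm]

theorem summable_sq_weight_cubic (hp0 : ∀ n, 0 ≤ p n)
    (hp : ∀ a b c n, a + c = b + n → p n ≤ p a + p c) (h1 : Summable fun n => ‖u n‖)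
    (h2 : Summable fun n => p n ^ 2 * ‖u n‖ ^ 2) :
    (Summable fun n => p n ^ 2 * (‖cubic u n‖ * ‖u n‖)) ∧
    ∑' n, p n ^ 2 * (‖cubic u n‖ * ‖u n‖) ≤
      4 * (∑' n, ‖u n‖) ^ 2 * ∑' n, p n ^ 2 * ‖u n‖ ^ 2 := by
  have hW : 0 ≤ ∑' n, ‖u n‖ := tsum_nonneg fun n => norm_nonneg _
  have hy : 0 ≤ ∑' n, p n ^ 2 * ‖u n‖ ^ 2 := tsum_nonneg fun n => by positivity
  refine summable_and_tsum_le_of_ennreal (fun n => by positivity) (by positivity) ?_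
  have := ENNReal.tsum_quad_le (fun n => ENNReal.ofReal (p n)) (fun n => ‖u n‖ₑ)
    (ofReal_weight_add_le hp0 hp)
  rw [tsum_enorm_eq_ofReal h1, tsum_weight_sq hp0 h2] at this
  calc ∑' n, ENNReal.ofReal (p n ^ 2 * (‖cubic u n‖ * ‖u n‖))
      ≤ ∑' n, ∑' a, ∑' b, ∑' c, (if a + c = b + n then
        ENNReal.ofReal (p n) ^ 2 * (‖u a‖ₑ * ‖u b‖ₑ * ‖u c‖ₑ * ‖u n‖ₑ) else 0) := by
        refine ENNReal.tsum_le_tsum fun n => ?_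
        rw [ENNReal.ofReal_mul (by positivity), ENNReal.ofReal_pow (hp0 n),
          ENNReal.ofReal_mul (by positivity), ofReal_norm, ofReal_norm]
        calc _ ≤ ENNReal.ofReal (p n) ^ 2 * ((∑' a, ∑' b, ∑' c,
              (if a + c = b + n then ‖u a‖ₑ * ‖u b‖ₑ * ‖u c‖ₑ else 0)) * ‖u n‖ₑ) := by
              gcongr
              exact enorm_cubic_le u n
          _ = _ := by
              simp only [← ENNReal.tsum_mul_left, ← ENNReal.tsum_mul_right, ite_mul, mul_ite,
                zero_mul, mul_zero]
    _ ≤ _ := by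
        rw [ENNReal.tsum_comm_quad]
        refine this.trans (le_of_eq ?_)
        rw [ENNReal.ofReal_mul (by positivity), ENNReal.ofReal_mul (by positivity),
          ENNReal.ofReal_pow hW]
        simp

theorem summable_weight_cubic (hp0 : ∀ n, 0 ≤ p n)
    (hp : ∀ a b c n, a + c = b + n → p n ≤ p a + p c) (h1 : Summable fun n => ‖u n‖)
    (h2 : Summable fun n => p n * ‖u n‖) :
    (Summable fun n => p n * ‖cubic u n‖) ∧
    ∑' n, p n * ‖cubic u n‖ ≤ 2 * (∑' n, ‖u n‖) ^ 2 * ∑' n, p n * ‖u n‖ := by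
  have hW : 0 ≤ ∑' n, ‖u n‖ := tsum_nonneg fun n => norm_nonneg _
  have hpn : ∀ n, 0 ≤ p n * ‖u n‖ := fun n => mul_nonneg (hp0 n) (norm_nonneg _)
  have hy : 0 ≤ ∑' n, p n * ‖u n‖ := tsum_nonneg hpn
  refine summable_and_tsum_le_of_ennreal (fun n => mul_nonneg (hp0 n) (norm_nonneg _))
    (by positivity) ?_
  have := ENNReal.tsum_cubic_le (fun n => ENNReal.ofReal (p n)) (fun n => ‖u n‖ₑ)
    (ofReal_weight_add_le hp0 hp)
  rw [tsum_enorm_eq_ofReal h1] at this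
  calc ∑' n, ENNReal.ofReal (p n * ‖cubic u n‖)
      ≤ ∑' n, ∑' a, ∑' b, ∑' c, (if a + c = b + n then
        ENNReal.ofReal (p n) * (‖u a‖ₑ * ‖u b‖ₑ * ‖u c‖ₑ) else 0) := by
        refine ENNReal.tsum_le_tsum fun n => ?_
        rw [ENNReal.ofReal_mul (hp0 n), ofReal_norm]
        calc _ ≤ ENNReal.ofReal (p n) * ((∑' a, ∑' b, ∑' c,
              (if a + c = b + n then ‖u a‖ₑ * ‖u b‖ₑ * ‖u c‖ₑ else 0))) := by
              gcongr
              exact enorm_cubic_le u n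
          _ = _ := by
              simp only [← ENNReal.tsum_mul_left, mul_ite, mul_zero]
    _ ≤ _ := by
        rw [ENNReal.tsum_comm_quad]
        refine this.trans (le_of_eq ?_)
        rw [ENNReal.ofReal_mul (by positivity), ENNReal.ofReal_mul (by positivity),
          ENNReal.ofReal_pow hW, ENNReal.ofReal_tsum_of_nonneg hpn h2]
        congr 1
        · simp
        · refine tsum_congr fun n => ?_
          rw [ENNReal.ofReal_mul (hp0 n), ofReal_norm]

/-- The quartic resonant term `u_a ū_b u_c ū_n` on `a + c = b + n`, indexed by `(n, a, b, c)`. -/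
def quartic (u : ℕ → ℂ) (q : ℕ × ℕ × ℕ × ℕ) : ℂ :=
  if q.2.1 + q.2.2.2 = q.2.2.1 + q.1 then
    u q.2.1 * conj (u q.2.2.1) * u q.2.2.2 * conj (u q.1) else 0

theorem summable_weight_quartic (hp0 : ∀ n, 0 ≤ p n)
    (hp : ∀ a b c n, a + c = b + n → p n ≤ p a + p c) (h1 : Summable fun n => ‖u n‖)
    (h2 : Summable fun n => p n ^ 2 * ‖u n‖ ^ 2) :
    Summable fun q : ℕ × ℕ × ℕ × ℕ => ((p q.1 ^ 2 : ℝ) : ℂ) * quartic u q := by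
  refine Summable.of_norm (tsum_enorm_ne_top_iff_summable_norm.1 (ne_top_of_le_ne_top
    (b := 4 * (∑' n, ‖u n‖ₑ) ^ 2 * ∑' n, (ENNReal.ofReal (p n) * ‖u n‖ₑ) ^ 2) ?_ ?_))
  · rw [tsum_enorm_eq_ofReal h1, tsum_weight_sq hp0 h2]
    exact ENNReal.mul_ne_top (ENNReal.mul_ne_top (by simp) (by simp)) (by simp)
  · refine le_trans (le_of_eq ?_) (ENNReal.tsum_quad_le (fun n => ENNReal.ofReal (p n))
      (fun n => ‖u n‖ₑ) (ofReal_weight_add_le hp0 hp))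
    rw [← ENNReal.tsum_comm_quad, ENNReal.tsum_prod']
    refine tsum_congr fun n => ?_
    rw [ENNReal.tsum_prod']
    refine tsum_congr fun a => ?_
    rw [ENNReal.tsum_prod']
    refine tsum_congr fun b => tsum_congr fun c => ?_
    have hpe : ‖((p n ^ 2 : ℝ) : ℂ)‖ₑ = ENNReal.ofReal (p n) ^ 2 := by
      rw [← ofReal_norm, Complex.norm_real, Real.norm_of_nonneg (by positivity),
        ENNReal.ofReal_pow (hp0 n)]
    simp only [quartic]
    split_ifs <;> simp only [enorm_mul, hpe, RCLike.enorm_conj, mul_zero, enorm_zero]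

/-- Swapping the two conjugated indices. -/
def swapConj : ℕ × ℕ × ℕ × ℕ ≃ ℕ × ℕ × ℕ × ℕ where
  toFun q := (q.2.2.1, q.2.1, q.1, q.2.2.2)
  invFun q := (q.2.2.1, q.2.1, q.1, q.2.2.2)
  left_inv _ := rfl
  right_inv _ := rfl

/-- Exchanging conjugated and unconjugated indices. -/
def swapPairs : ℕ × ℕ × ℕ × ℕ ≃ ℕ × ℕ × ℕ × ℕ where
  toFun q := (q.2.1, q.1, q.2.2.2, q.2.2.1)
  invFun q := (q.2.1, q.1, q.2.2.2, q.2.2.1)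
  left_inv _ := rfl
  right_inv _ := rfl

theorem quartic_swapConj (u : ℕ → ℂ) (q) : quartic u (swapConj q) = quartic u q := by
  obtain ⟨n, a, b, c⟩ := q
  simp only [quartic, swapConj, Equiv.coe_fn_mk, add_comm n b]
  split_ifs
  · ring
  · rfl

theorem quartic_swapPairs (u : ℕ → ℂ) (q) : quartic u (swapPairs q) = conj (quartic u q) := by
  obtain ⟨n, a, b, c⟩ := q
  have : (n + b = c + a) ↔ (a + c = b + n) := by omega
  simp only [quartic, swapPairs, Equiv.coe_fn_mk, this]
  split_ifs
  · simp only [map_mul, Complex.conj_conj]; ring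
  · simp

theorem im_tsum_cubic_eq_zero (h1 : Summable fun n => ‖u n‖)
    (h2 : Summable fun n : ℕ => ((n : ℝ) + 1) * ‖u n‖ ^ 2)
    (hp : ∀ a b c n : ℕ, a + c = b + n → √((n : ℝ) + 1) ≤ √((a : ℝ) + 1) + √((c : ℝ) + 1)) :
    HasSum (fun n : ℕ => ((n : ℝ) + 1) * (cubic u n * conj (u n)).im) 0 := by
  have hsq : ∀ n : ℕ, √((n : ℝ) + 1) ^ 2 = (n : ℝ) + 1 := fun n => Real.sq_sqrt (by positivity)
  have hS : Summable fun q : ℕ × ℕ × ℕ × ℕ => ((q.1 : ℂ) + 1) * quartic u q := by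
    have := summable_weight_quartic (p := fun n : ℕ => √((n : ℝ) + 1)) (u := u)
      (fun n => Real.sqrt_nonneg _) hp h1 (by simpa only [hsq] using h2)
    simp only [hsq] at this
    simpa using this
  have hSb : Summable fun q : ℕ × ℕ × ℕ × ℕ => ((q.2.2.1 : ℂ) + 1) * quartic u q := by
    have := (swapConj.summable_iff).2 hS
    simp only [Function.comp_def, quartic_swapConj] at this
    exact this
  have eb : ∑' q : ℕ × ℕ × ℕ × ℕ, ((q.2.2.1 : ℂ) + 1) * quartic u q
      = ∑' q : ℕ × ℕ × ℕ × ℕ, ((q.1 : ℂ) + 1) * quartic u q := by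
    rw [← swapConj.tsum_eq (fun q : ℕ × ℕ × ℕ × ℕ => ((q.1 : ℂ) + 1) * quartic u q)]
    simp only [quartic_swapConj]
    rfl
  set S := ∑' q : ℕ × ℕ × ℕ × ℕ, ((q.1 : ℂ) + 1) * quartic u q with hSdef
  have hnb : S + S = ∑' q : ℕ × ℕ × ℕ × ℕ, ((q.1 : ℂ) + q.2.2.1 + 2) * quartic u q := by
    nth_rewrite 2 [← eb]
    rw [hSdef, ← hS.tsum_add hSb]
    exact tsum_congr fun q => by ring
  have hconj : conj (S + S) = S + S := by
    rw [hnb, conj_tsum]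
    rw [← swapPairs.tsum_eq]
    refine tsum_congr fun q => ?_
    rw [map_mul, quartic_swapPairs, Complex.conj_conj]
    obtain ⟨n, a, b, c⟩ := q
    by_cases h : a + c = b + n
    · have : ((a : ℂ) + c) = b + n := by exact_mod_cast h
      simp only [swapPairs, Equiv.coe_fn_mk, map_add, Complex.conj_natCast, map_ofNat]
      rw [this]; ring
    · simp [quartic, h]
  have him : S.im = 0 := by
    have := congrArg Complex.im hconj
    simp at this
    linarith
  have hfib := hS.hasSum.prod_fiberwise (fun n => (hS.prod_factor n).hasSum)
  have hfib' : HasSum (fun n : ℕ => ((n : ℂ) + 1) * (cubic u n * conj (u n))) S := by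
    convert hfib using 2 with n
    rw [cubic, ← tsum_mul_right, ← tsum_mul_left]
    refine tsum_congr fun q => ?_
    simp only [quartic]
    split_ifs <;> simp
  have := Complex.hasSum_iff _ _ |>.1 hfib' |>.2
  rw [him] at this
  convert this using 2 with n
  rw [← Complex.ofReal_natCast, ← Complex.ofReal_one, ← Complex.ofReal_add, Complex.im_ofReal_mul]

end Weights

theorem summable_mul_and_sq_tsum_mul_le {f g : ℕ → ℝ} (hf0 : ∀ n, 0 ≤ f n) (hg0 : ∀ n, 0 ≤ g n)
    (hf : Summable fun n => f n ^ 2) (hg : Summable fun n => g n ^ 2) :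
    (Summable fun n => f n * g n) ∧
      (∑' n, f n * g n) ^ 2 ≤ (∑' n, f n ^ 2) * ∑' n, g n ^ 2 := by
  have hF : 0 ≤ ∑' n, f n ^ 2 := tsum_nonneg fun n => sq_nonneg _
  have hG : 0 ≤ ∑' n, g n ^ 2 := tsum_nonneg fun n => sq_nonneg _
  have h0 : ∀ n, 0 ≤ f n * g n := fun n => mul_nonneg (hf0 n) (hg0 n)
  have key : ∀ s : Finset ℕ, ∑ n ∈ s, f n * g n ≤ √((∑' n, f n ^ 2) * ∑' n, g n ^ 2) := by
    intro s
    refine Real.le_sqrt_of_sq_le ((Finset.sum_mul_sq_le_sq_mul_sq s f g).trans ?_)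
    exact mul_le_mul (hf.sum_le_tsum s fun n _ => sq_nonneg _)
      (hg.sum_le_tsum s fun n _ => sq_nonneg _) (Finset.sum_nonneg fun n _ => sq_nonneg _) hF
  refine ⟨summable_of_sum_le h0 key, ?_⟩
  calc (∑' n, f n * g n) ^ 2 ≤ √((∑' n, f n ^ 2) * ∑' n, g n ^ 2) ^ 2 :=
        pow_le_pow_left₀ (tsum_nonneg h0) (Real.tsum_le_of_sum_le h0 key) 2
    _ = _ := Real.sq_sqrt (mul_nonneg hF hG)

/-- The weight `(n + 1) ^ σ`. -/
def wt (σ : ℝ) (n : ℕ) : ℝ := ((n : ℝ) + 1) ^ σ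

theorem wt_pos (σ : ℝ) (n : ℕ) : 0 < wt σ n := Real.rpow_pos_of_pos (by positivity) _

theorem wt_mul (σ τ : ℝ) (n : ℕ) : wt σ n * wt τ n = wt (σ + τ) n :=
  (Real.rpow_add (by positivity) _ _).symm

theorem wt_sq (σ : ℝ) (n : ℕ) : wt σ n ^ 2 = wt (2 * σ) n := by rw [sq, wt_mul, two_mul]

theorem wt_one (n : ℕ) : wt 1 n = (n : ℝ) + 1 := Real.rpow_one _

theorem wt_zero (n : ℕ) : wt 0 n = 1 := Real.rpow_zero _

theorem wt_mono_exp {σ τ : ℝ} (h : σ ≤ τ) (n : ℕ) : wt σ n ≤ wt τ n :=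
  Real.rpow_le_rpow_of_exponent_le (by linarith [n.cast_nonneg (α := ℝ)]) h

theorem one_le_wt {σ : ℝ} (h : 0 ≤ σ) (n : ℕ) : 1 ≤ wt σ n := by
  simpa [wt_zero] using wt_mono_exp h n

theorem wt_mono {σ : ℝ} (h : 0 ≤ σ) {m n : ℕ} (hmn : m ≤ n) : wt σ m ≤ wt σ n :=
  Real.rpow_le_rpow (by positivity) (by gcongr) h

theorem wt_neg (σ : ℝ) (n : ℕ) : wt (-σ) n = (wt σ n)⁻¹ := Real.rpow_neg (by positivity) _

theorem wt_add_le {σ : ℝ} (h0 : 0 ≤ σ) (h1 : σ ≤ 1) (a b c n : ℕ) (h : a + c = b + n) :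
    wt σ n ≤ wt σ a + wt σ c := by
  refine le_trans ?_ (Real.rpow_add_le_add_rpow (by positivity) (by positivity) h0 h1)
  refine Real.rpow_le_rpow (by positivity) ?_ h0
  have : (n : ℝ) ≤ a + c := by exact_mod_cast (by omega : n ≤ a + c)
  linarith

theorem summable_wt_neg {σ : ℝ} (h : 1 < σ) : Summable (wt (-σ)) := by
  have := (summable_nat_add_iff 1).2 (Real.summable_nat_rpow.2 (neg_lt_neg h))
  have h2 : Summable fun n : ℕ => ((n : ℝ) + 1) ^ (-σ) := by simpa using this
  exact h2

theorem tendsto_wt_neg {σ : ℝ} (h : 0 < σ) : Tendsto (wt (-σ)) atTop (𝓝 0) :=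
  (tendsto_rpow_neg_atTop h).comp
    (tendsto_atTop_add_const_right _ _ tendsto_natCast_atTop_atTop)

/-- A weighted summable sequence has quantitatively small tails. -/
theorem tsum_tail_le {δ : ℝ} (hδ : 0 ≤ δ) {f : ℕ → ℝ} (hf0 : ∀ n, 0 ≤ f n)
    (hf : Summable fun n => wt δ n * f n) (N : ℕ) :
    Summable f ∧ ∑' n, f (n + N) ≤ wt (-δ) N * ∑' n, wt δ n * f n := by
  have hle : ∀ n, f n ≤ wt δ n * f n := fun n =>
    le_mul_of_one_le_left (hf0 n) (one_le_wt hδ n)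
  have hs : Summable f := Summable.of_nonneg_of_le hf0 hle hf
  refine ⟨hs, ?_⟩
  have hN := (summable_nat_add_iff N).2 hf
  calc ∑' n, f (n + N) ≤ ∑' n, wt (-δ) N * (wt δ (n + N) * f (n + N)) := by
        refine ((summable_nat_add_iff N).2 hs).tsum_le_tsum (fun n => ?_) (hN.mul_left _)
        rw [← mul_assoc, wt_neg]
        refine le_mul_of_one_le_left (hf0 _) ?_
        rw [inv_mul_eq_div, one_le_div (wt_pos _ _)]
        exact wt_mono hδ (by omega)
    _ = wt (-δ) N * ∑' n, wt δ (n + N) * f (n + N) := tsum_mul_left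
    _ ≤ _ := by
        refine mul_le_mul_of_nonneg_left ?_ (wt_pos _ _).le
        rw [← hf.sum_add_tsum_nat_add N]
        exact le_add_of_nonneg_left
          (Finset.sum_nonneg fun n _ => mul_nonneg (wt_pos _ _).le (hf0 n))

/-- The weighted squared norm `∑ (n + 1) ^ (2σ) |u_n|²`. -/
def wnorm (σ : ℝ) (u : ℕ → ℂ) : ℝ := ∑' n, wt σ n ^ 2 * ‖u n‖ ^ 2

/-- Finiteness of `wnorm`. -/
def FinWnorm (σ : ℝ) (u : ℕ → ℂ) : Prop := Summable fun n => wt σ n ^ 2 * ‖u n‖ ^ 2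

theorem wnorm_nonneg (σ : ℝ) (u : ℕ → ℂ) : 0 ≤ wnorm σ u := tsum_nonneg fun n => by positivity

theorem MemHs.finWnorm {s σ : ℝ} (h0 : 0 ≤ σ) (h1 : σ ≤ 1) (hs : σ ≤ s) {u : ℕ → ℂ}
    (h : MemHs s u) : FinWnorm σ u := by
  refine Summable.of_nonneg_of_le (fun n => by positivity) (fun n => ?_) (h.mul_left 2)
  have hn : (0 : ℝ) ≤ n := n.cast_nonneg
  rw [← mul_assoc]
  refine mul_le_mul_of_nonneg_right ?_ (by positivity)
  calc wt σ n ^ 2 = (((n : ℝ) + 1) ^ 2) ^ σ := by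
        rw [wt, ← Real.rpow_natCast, ← Real.rpow_natCast, ← Real.rpow_mul (by positivity),
          ← Real.rpow_mul (by positivity), mul_comm]
    _ ≤ (2 * (1 + (n : ℝ) ^ 2)) ^ σ :=
        Real.rpow_le_rpow (by positivity) (by nlinarith [sq_nonneg ((n : ℝ) - 1)]) h0
    _ = 2 ^ σ * (1 + (n : ℝ) ^ 2) ^ σ := Real.mul_rpow (by norm_num) (by positivity)
    _ ≤ 2 * (1 + (n : ℝ) ^ 2) ^ s := by
        refine mul_le_mul ?_ ?_ (by positivity) (by norm_num)
        · simpa using Real.rpow_le_rpow_of_exponent_le (by norm_num : (1 : ℝ) ≤ 2) h1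
        · exact Real.rpow_le_rpow_of_exponent_le (by nlinarith) hs

theorem FinWnorm.mono {σ τ : ℝ} (h : σ ≤ τ) {u : ℕ → ℂ} (hu : FinWnorm τ u) : FinWnorm σ u :=
  Summable.of_nonneg_of_le (fun n => by positivity)
    (fun n => mul_le_mul_of_nonneg_right
      (pow_le_pow_left₀ (wt_pos _ _).le (wt_mono_exp h n) 2) (by positivity)) hu

theorem wnorm_mono {σ τ : ℝ} (h : σ ≤ τ) {u : ℕ → ℂ} (hu : FinWnorm τ u) :
    wnorm σ u ≤ wnorm τ u :=
  (hu.mono h).tsum_le_tsum (fun n => mul_le_mul_of_nonneg_right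
      (pow_le_pow_left₀ (wt_pos _ _).le (wt_mono_exp h n) 2) (by positivity)) hu

theorem wt_half_sq (n : ℕ) : wt (1 / 2) n ^ 2 = (n : ℝ) + 1 := by
  rw [wt_sq, ← wt_one]; norm_num

/-- Weighted `ℓ¹` control by the weighted `ℓ²` norm. -/
theorem FinWnorm.l1 {σ : ℝ} (hσ : 1 / 2 < σ) {u : ℕ → ℂ} (hu : FinWnorm σ u) :
    (Summable fun n => wt ((2 * σ - 1) / 4) n * ‖u n‖) ∧
      (∑' n, wt ((2 * σ - 1) / 4) n * ‖u n‖) ^ 2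
        ≤ (∑' n, wt (-(σ + 1 / 2)) n) * wnorm σ u := by
  have e1 : ∀ n, wt ((2 * σ - 1) / 4 - σ) n ^ 2 = wt (-(σ + 1 / 2)) n := fun n => by
    rw [wt_sq]; congr 1; ring
  have e2 : ∀ n, wt ((2 * σ - 1) / 4 - σ) n * (wt σ n * ‖u n‖)
      = wt ((2 * σ - 1) / 4) n * ‖u n‖ := fun n => by
    rw [← mul_assoc, wt_mul, sub_add_cancel]
  have := summable_mul_and_sq_tsum_mul_le (f := fun n => wt ((2 * σ - 1) / 4 - σ) n)
    (g := fun n => wt σ n * ‖u n‖) (fun n => (wt_pos _ _).le)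
    (fun n => mul_nonneg (wt_pos _ _).le (norm_nonneg _))
    (by simpa only [e1] using summable_wt_neg (by linarith))
    (by simp only [mul_pow]; exact hu)
  simp only [e1, e2, mul_pow] at this
  exact this

theorem FinWnorm.summable_norm {σ : ℝ} (hσ : 1 / 2 < σ) {u : ℕ → ℂ} (hu : FinWnorm σ u) :
    Summable fun n => ‖u n‖ :=
  (tsum_tail_le (by linarith) (fun _ => norm_nonneg _) (hu.l1 hσ).1 0).1

theorem FinWnorm.tsum_norm_le {σ : ℝ} (hσ : 1 / 2 < σ) {u : ℕ → ℂ} (hu : FinWnorm σ u) :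
    ∑' n, ‖u n‖ ≤ ∑' n, wt ((2 * σ - 1) / 4) n * ‖u n‖ :=
  (hu.summable_norm hσ).tsum_le_tsum
    (fun n => le_mul_of_one_le_left (norm_nonneg _) (one_le_wt (by linarith) n)) (hu.l1 hσ).1

theorem FinWnorm.sq_tsum_norm_le {σ : ℝ} (hσ : 1 / 2 < σ) {u : ℕ → ℂ} (hu : FinWnorm σ u) :
    (∑' n, ‖u n‖) ^ 2 ≤ (∑' n, wt (-(σ + 1 / 2)) n) * wnorm σ u :=
  (pow_le_pow_left₀ (tsum_nonneg fun _ => norm_nonneg _) (hu.tsum_norm_le hσ) 2).trans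
    (hu.l1 hσ).2

/-- Brezis–Gallouët type inequality for the Wiener norm. -/
theorem exists_sq_tsum_norm_le_log {σ : ℝ} (hσ : 1 / 2 < σ) :
    ∃ C : ℝ, 0 < C ∧ ∀ u : ℕ → ℂ, FinWnorm σ u → ∀ B, wnorm σ u ≤ B →
      (∑' n, ‖u n‖) ^ 2 ≤ C * (1 + wnorm (1 / 2) u) * (1 + Real.log (1 + B)) := by
  set δ := (2 * σ - 1) / 4 with hδdef
  have hδ : 0 < δ := by rw [hδdef]; linarith
  set K := ∑' n, wt (-(σ + 1 / 2)) n
  have hK : 0 ≤ K := tsum_nonneg fun n => (wt_pos _ _).le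
  refine ⟨4 + 1 / δ + 2 * K, by positivity, fun u hu B hB => ?_⟩
  have hB0 : 0 ≤ B := (wnorm_nonneg σ u).trans hB
  obtain ⟨hs, hl1⟩ := hu.l1 hσ
  set E := wnorm (1 / 2) u with hE
  have hE0 : 0 ≤ E := wnorm_nonneg _ _
  set ℓ := Real.log (1 + B)
  have hℓ : 0 ≤ ℓ := Real.log_nonneg (by linarith)
  set X := (1 + B) ^ (1 / (2 * δ)) with hX
  have hX1 : 1 ≤ X := Real.one_le_rpow (by linarith) (by positivity)
  set N := ⌈X⌉₊
  have hNX : X ≤ N := Nat.le_ceil X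
  have hN2 : (N : ℝ) ≤ 2 * X := by
    have := (Nat.ceil_lt_add_one (by linarith : 0 ≤ X)).le
    linarith
  have hlogN : Real.log N ≤ 1 + 1 / (2 * δ) * ℓ := by
    calc Real.log N ≤ Real.log (2 * X) := Real.log_le_log (by linarith) hN2
      _ = Real.log 2 + 1 / (2 * δ) * ℓ := by
          rw [Real.log_mul (by norm_num) (by linarith), hX, Real.log_rpow (by linarith)]
      _ ≤ _ := by linarith [Real.log_two_lt_d9]
  have hhead : (∑ n ∈ Finset.range N, ‖u n‖) ^ 2 ≤ (2 + 1 / (2 * δ) * ℓ) * E := by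
    have h1 : ∀ n : ℕ, ‖u n‖ = wt (-(1 / 2)) n * (wt (1 / 2) n * ‖u n‖) := fun n => by
      rw [← mul_assoc, wt_mul]; simp [wt_zero]
    calc (∑ n ∈ Finset.range N, ‖u n‖) ^ 2
        = (∑ n ∈ Finset.range N, wt (-(1 / 2)) n * (wt (1 / 2) n * ‖u n‖)) ^ 2 := by
          simp_rw [← h1]
      _ ≤ (∑ n ∈ Finset.range N, wt (-(1 / 2)) n ^ 2) *
          ∑ n ∈ Finset.range N, (wt (1 / 2) n * ‖u n‖) ^ 2 := Finset.sum_mul_sq_le_sq_mul_sq _ _ _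
      _ ≤ (1 + Real.log N) * E := by
          refine mul_le_mul ?_ ?_ (Finset.sum_nonneg fun n _ => sq_nonneg _)
            (by linarith [Real.log_nonneg (hX1.trans hNX)])
          · refine le_trans (le_of_eq ?_) (harmonic_le_one_add_log N)
            rw [harmonic]
            push_cast
            refine Finset.sum_congr rfl fun n _ => ?_
            rw [wt_neg, inv_pow, wt_half_sq]
          · simp_rw [mul_pow]
            exact (hu.mono hσ.le).sum_le_tsum _ fun n _ => by positivity
      _ ≤ _ := mul_le_mul_of_nonneg_right (by linarith) hE0
  have htail : (∑' n, ‖u (n + N)‖) ^ 2 ≤ K := by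
    have h1 := (tsum_tail_le hδ.le (fun n => norm_nonneg (u n)) hs N).2
    calc (∑' n, ‖u (n + N)‖) ^ 2 ≤ (wt (-δ) N * ∑' n, wt δ n * ‖u n‖) ^ 2 :=
          pow_le_pow_left₀ (tsum_nonneg fun _ => norm_nonneg _) h1 2
      _ = (wt δ N ^ 2)⁻¹ * (∑' n, wt δ n * ‖u n‖) ^ 2 := by rw [mul_pow, wt_neg, inv_pow]
      _ ≤ (1 + B)⁻¹ * (K * B) := by
          have h2 : 1 + B ≤ wt δ N ^ 2 := by
            rw [wt_sq]
            calc 1 + B = X ^ (2 * δ) := by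
                  rw [hX, ← Real.rpow_mul (by linarith)]
                  rw [one_div_mul_cancel (by positivity), Real.rpow_one]
              _ ≤ _ := Real.rpow_le_rpow (by linarith) (by linarith) (by positivity)
          gcongr
          exact hl1.trans (by gcongr)
      _ ≤ K := by
          rw [inv_mul_le_iff₀ (by linarith)]
          nlinarith
  rw [← (hu.summable_norm hσ).sum_add_tsum_nat_add N]
  calc _ ≤ 2 * ((2 + 1 / (2 * δ) * ℓ) * E + K) := by
        nlinarith [sq_nonneg (∑ n ∈ Finset.range N, ‖u n‖ - ∑' n, ‖u (n + N)‖)]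
    _ = (4 + 1 / δ * ℓ) * E + 2 * K := by field_simp; ring
    _ ≤ _ := by
        have : 0 < 1 / δ := by positivity
        generalize 1 / δ = D at *
        have h1 : 0 ≤ D * E := by positivity
        have h2 : 0 ≤ E * ℓ := by positivity
        have h3 : 0 ≤ K * (E + ℓ + E * ℓ) := by positivity
        have h4 : 0 ≤ D * ℓ := by positivity
        nlinarith

section Evolution

variable {α : ℝ} {u : ℝ → ℕ → ℂ}

theorem SolvesSzego.hasDerivAt_norm_sq (hsol : SolvesSzego α u) (n : ℕ) (t : ℝ) :
    HasDerivAt (fun τ => ‖u τ n‖ ^ 2) (2 * (cubic (u t) n * conj (u t n)).im) t := by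
  refine (hsol n t).norm_sq.congr_deriv ?_
  rw [Complex.inner]
  by_cases hn : n = 0
  · subst hn
    simp [oneSeq, Complex.mul_re, Complex.mul_im]
    ring
  · simp [oneSeq, hn, Complex.mul_re, Complex.mul_im]

theorem SolvesSzego.abs_tsum_sub_le (hsol : SolvesSzego α u) {q : ℕ → ℝ} {t t' : ℝ}
    (hq : ∀ τ ∈ Set.uIcc t t', Summable fun n => q n * ‖u τ n‖ ^ 2) {C : ℕ → ℝ} {c : ℝ}
    (hC : Tendsto C atTop (𝓝 c))
    (h : ∀ N, ∀ τ ∈ Set.uIcc t t',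
      |∑ n ∈ Finset.range N, q n * (2 * (cubic (u τ) n * conj (u τ n)).im)| ≤ C N) :
    |∑' n, q n * ‖u t' n‖ ^ 2 - ∑' n, q n * ‖u t n‖ ^ 2| ≤ c * |t' - t| := by
  have hN : ∀ N, |∑ n ∈ Finset.range N, q n * ‖u t' n‖ ^ 2 -
      ∑ n ∈ Finset.range N, q n * ‖u t n‖ ^ 2| ≤ C N * |t' - t| := fun N =>
    (convex_uIcc t t').norm_image_sub_le_of_norm_hasDerivWithin_le
      (fun τ _ => (HasDerivAt.fun_sum fun n _ =>
        (hsol.hasDerivAt_norm_sq n τ).const_mul (q n)).hasDerivWithinAt)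
      (h N) Set.left_mem_uIcc Set.right_mem_uIcc
  refine le_of_tendsto_of_tendsto' ?_ (hC.mul_const _) hN
  exact ((hq _ Set.right_mem_uIcc).hasSum.tendsto_sum_nat.sub
    (hq _ Set.left_mem_uIcc).hasSum.tendsto_sum_nat).abs

variable {σ : ℝ}

theorem FinWnorm.cubic (h0 : 1 / 2 < σ) (h1 : σ ≤ 1) {v : ℕ → ℂ} (hv : FinWnorm σ v) :
    (Summable fun n => wt σ n ^ 2 * (‖_root_.cubic v n‖ * ‖v n‖)) ∧
      ∑' n, wt σ n ^ 2 * (‖_root_.cubic v n‖ * ‖v n‖) ≤ 4 * (∑' n, ‖v n‖) ^ 2 * wnorm σ v :=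
  summable_sq_weight_cubic (fun n => (wt_pos _ _).le) (wt_add_le (by linarith) h1)
    (hv.summable_norm h0) hv

theorem abs_im_mul_conj_le (z w : ℂ) : |(z * conj w).im| ≤ ‖z‖ * ‖w‖ :=
  (Complex.abs_im_le_norm _).trans (by simp)

/-- Truncations of the energy have small derivative. -/
theorem FinWnorm.abs_sum_energy_le (h0 : 1 / 2 < σ) (h1 : σ ≤ 1) {v : ℕ → ℂ}
    (hv : FinWnorm σ v) (N : ℕ) :
    |∑ n ∈ Finset.range N, ((n : ℝ) + 1) * (_root_.cubic v n * conj (v n)).im|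
      ≤ wt (-(2 * σ - 1)) N * (4 * (∑' n, ‖v n‖) ^ 2 * wnorm σ v) := by
  have hz := im_tsum_cubic_eq_zero (u := v) (hv.summable_norm h0)
    (by simpa only [FinWnorm, wt_half_sq] using hv.mono (σ := 1 / 2) h0.le)
    (fun a b c n h => by
      simpa only [wt, ← Real.sqrt_eq_rpow] using
        wt_add_le (σ := 1 / 2) (by norm_num) (by norm_num) a b c n h)
  have hc := hv.cubic h0 h1
  have hw : ∀ n, wt (2 * σ - 1) n * ((n : ℝ) + 1) = wt σ n ^ 2 := fun n => by
    rw [← wt_one, wt_mul, wt_sq, sub_add_cancel]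
  have hf : Summable fun n : ℕ =>
      wt (2 * σ - 1) n * (((n : ℝ) + 1) * (‖_root_.cubic v n‖ * ‖v n‖)) := by
    simpa only [← mul_assoc, hw] using hc.1
  have ht := tsum_tail_le (δ := 2 * σ - 1) (by linarith) (fun n => by positivity) hf N
  have hle : ∀ n : ℕ, ‖((n : ℝ) + 1) * (_root_.cubic v n * conj (v n)).im‖
      ≤ ((n : ℝ) + 1) * (‖_root_.cubic v n‖ * ‖v n‖) := fun n => by
    rw [norm_mul, Real.norm_of_nonneg (by positivity : (0 : ℝ) ≤ (n : ℝ) + 1)]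
    exact mul_le_mul_of_nonneg_left (abs_im_mul_conj_le _ _) (by positivity)
  have hsplit := hz.summable.sum_add_tsum_nat_add N
  rw [hz.tsum_eq] at hsplit
  rw [eq_neg_of_add_eq_zero_left hsplit, abs_neg]
  calc _ ≤ ∑' n, ((((n + N : ℕ) : ℝ) + 1) * (‖_root_.cubic v (n + N)‖ * ‖v (n + N)‖)) :=
        tsum_of_norm_bounded ((summable_nat_add_iff N).2 ht.1).hasSum fun n => hle (n + N)
    _ ≤ _ := ht.2
    _ ≤ _ := by
        refine mul_le_mul_of_nonneg_left (le_trans (le_of_eq ?_) hc.2) (wt_pos _ _).le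
        exact tsum_congr fun n => by rw [← mul_assoc, hw]

/-- Conservation of the `H^{1/2}` norm, given boundedness in a stronger norm. -/
theorem SolvesSzego.wnorm_half_eq (hsol : SolvesSzego α u) (h0 : 1 / 2 < σ) (h1 : σ ≤ 1)
    (hfin : ∀ t, FinWnorm σ (u t)) {t t' B : ℝ}
    (hB : ∀ τ ∈ Set.uIcc t t', wnorm σ (u τ) ≤ B) :
    wnorm (1 / 2) (u t') = wnorm (1 / 2) (u t) := by
  set K := ∑' n, wt (-(σ + 1 / 2)) n
  have hK : 0 ≤ K := tsum_nonneg fun _ => (wt_pos _ _).le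
  have hB0 : 0 ≤ B := (wnorm_nonneg _ _).trans (hB t Set.left_mem_uIcc)
  have key := hsol.abs_tsum_sub_le (q := fun n => wt (1 / 2) n ^ 2) (t := t) (t' := t')
    (C := fun N => wt (-(2 * σ - 1)) N * (2 * (4 * (K * B) * B))) (c := 0)
    (fun τ _ => (hfin τ).mono h0.le)
    (by
      have := (tendsto_wt_neg (by linarith : 0 < 2 * σ - 1)).mul_const (2 * (4 * (K * B) * B))
      rwa [zero_mul] at this)
    (fun N τ hτ => by
      have h2 := (hfin τ).abs_sum_energy_le h0 h1 N
      have h3 : (∑' n, ‖u τ n‖) ^ 2 ≤ K * B :=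
        ((hfin τ).sq_tsum_norm_le h0).trans (mul_le_mul_of_nonneg_left (hB τ hτ) hK)
      have h4 : 4 * (∑' n, ‖u τ n‖) ^ 2 * wnorm σ (u τ) ≤ 4 * (K * B) * B :=
        mul_le_mul (by linarith) (hB τ hτ) (wnorm_nonneg _ _) (by positivity)
      have h5 := h2.trans (mul_le_mul_of_nonneg_left h4 (wt_pos _ _).le)
      simp only [wt_half_sq]
      have e : ∑ n ∈ Finset.range N, ((n : ℝ) + 1) * (2 * (cubic (u τ) n * conj (u τ n)).im)
          = 2 * ∑ n ∈ Finset.range N, ((n : ℝ) + 1) * (cubic (u τ) n * conj (u τ n)).im := by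
        rw [Finset.mul_sum]; exact Finset.sum_congr rfl fun n _ => by ring
      rw [e, abs_mul, abs_of_pos (by norm_num : (0 : ℝ) < 2)]
      linarith)
  rw [zero_mul] at key
  exact sub_eq_zero.1 (abs_nonpos_iff.1 key)

/-- The `wnorm` is Lipschitz in time with an almost linear rate. -/
theorem SolvesSzego.abs_wnorm_sub_le (hsol : SolvesSzego α u) (h0 : 1 / 2 < σ) (h1 : σ ≤ 1)
    (hfin : ∀ t, FinWnorm σ (u t)) {C : ℝ} (hC0 : 0 < C)
    (hC : ∀ v : ℕ → ℂ, FinWnorm σ v → ∀ B, wnorm σ v ≤ B →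
      (∑' n, ‖v n‖) ^ 2 ≤ C * (1 + wnorm (1 / 2) v) * (1 + Real.log (1 + B)))
    {t t' B : ℝ} (hB : ∀ τ ∈ Set.uIcc t t', wnorm σ (u τ) ≤ B) :
    |wnorm σ (u t') - wnorm σ (u t)| ≤
      8 * C * (1 + wnorm (1 / 2) (u t)) * (1 + Real.log (1 + B)) * B * |t' - t| := by
  have hB0 : 0 ≤ B := (wnorm_nonneg _ _).trans (hB t Set.left_mem_uIcc)
  have hlog : 0 ≤ Real.log (1 + B) := Real.log_nonneg (by linarith)
  refine hsol.abs_tsum_sub_le (fun τ _ => hfin τ) tendsto_const_nhds fun N τ hτ => ?_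
  have hE : wnorm (1 / 2) (u τ) = wnorm (1 / 2) (u t) :=
    hsol.wnorm_half_eq h0 h1 hfin fun x hx =>
      hB x (Set.uIcc_subset_uIcc_left hτ hx)
  have hW := hC _ (hfin τ) B (hB τ hτ)
  rw [hE] at hW
  have hc := (hfin τ).cubic h0 h1
  have hE0 := wnorm_nonneg (1 / 2) (u t)
  calc _ ≤ ∑ n ∈ Finset.range N, 2 * (wt σ n ^ 2 * (‖cubic (u τ) n‖ * ‖u τ n‖)) := by
        refine (Finset.abs_sum_le_sum_abs _ _).trans (Finset.sum_le_sum fun n _ => ?_)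
        rw [abs_mul, abs_mul, abs_of_nonneg (by positivity : 0 ≤ wt σ n ^ 2),
          abs_of_pos (by norm_num : (0 : ℝ) < 2)]
        have := mul_le_mul_of_nonneg_left (abs_im_mul_conj_le (cubic (u τ) n) (u τ n))
          (by positivity : 0 ≤ wt σ n ^ 2)
        linarith
    _ = 2 * ∑ n ∈ Finset.range N, (wt σ n ^ 2 * (‖cubic (u τ) n‖ * ‖u τ n‖)) := by
        rw [Finset.mul_sum]
    _ ≤ 2 * (4 * (∑' n, ‖u τ n‖) ^ 2 * wnorm σ (u τ)) :=
        mul_le_mul_of_nonneg_left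
          ((hc.1.sum_le_tsum _ fun n _ => by positivity).trans hc.2) (by norm_num)
    _ ≤ 2 * (4 * (C * (1 + wnorm (1 / 2) (u t)) * (1 + Real.log (1 + B))) * B) :=
        mul_le_mul_of_nonneg_left (mul_le_mul (by linarith) (hB τ hτ) (wnorm_nonneg _ _)
          (by positivity)) (by norm_num)
    _ = _ := by ring

end Evolution

/-- A double exponential bound for functions with almost linear growth rate. -/
theorem le_exp_exp_of_log_growth {g : ℝ → ℝ} {K T B₀ : ℝ} (hT : 0 ≤ T) (hK : 0 ≤ K)
    (hg0 : ∀ x ∈ Set.Icc 0 T, 0 ≤ g x) (hb : ∀ x ∈ Set.Icc 0 T, g x ≤ B₀)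
    (hlip : ∀ x ∈ Set.Icc 0 T, ∀ x' ∈ Set.Icc 0 T, x ≤ x' → ∀ B,
      (∀ τ ∈ Set.Icc x x', g τ ≤ B) → |g x' - g x| ≤ K * (1 + Real.log (1 + B)) * B * (x' - x)) :
    g T ≤ Real.exp (Real.exp (g 0 + (3 * K + 1) * T)) := by
  have h0T : (0 : ℝ) ∈ Set.Icc 0 T := ⟨le_rfl, hT⟩
  have hB₀ : 0 ≤ B₀ := (hg0 0 h0T).trans (hb 0 h0T)
  set L := K * (1 + Real.log (1 + B₀)) * B₀
  have hL : 0 ≤ L := by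
    have := Real.log_nonneg (by linarith : (1 : ℝ) ≤ 1 + B₀)
    positivity
  have hlip' : ∀ x ∈ Set.Icc 0 T, ∀ x' ∈ Set.Icc 0 T, x ≤ x' → |g x' - g x| ≤ L * (x' - x) :=
    fun x hx x' hx' hxx' => hlip x hx x' hx' hxx' B₀ fun τ hτ =>
      hb τ ⟨hx.1.trans hτ.1, hτ.2.trans hx'.2⟩
  have hcont : ContinuousOn g (Set.Icc 0 T) := by
    refine LipschitzOnWith.continuousOn (K := ⟨L, hL⟩) (LipschitzOnWith.of_dist_le_mul ?_)
    intro x hx x' hx'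
    change |g x - g x'| ≤ L * |x - x'|
    rcases le_total x x' with h | h
    · rw [abs_sub_comm, abs_sub_comm x, abs_of_nonneg (sub_nonneg.2 h)]
      exact hlip' x hx x' hx' h
    · rw [abs_of_nonneg (sub_nonneg.2 h)]
      exact hlip' x' hx' x hx h
  refine image_le_of_liminf_slope_right_lt_deriv_boundary'
    (f' := fun x => K * (1 + Real.log (1 + g x)) * g x)
    (B := fun x => Real.exp (Real.exp (g 0 + (3 * K + 1) * x)))
    (B' := fun x => Real.exp (Real.exp (g 0 + (3 * K + 1) * x)) *
      (Real.exp (g 0 + (3 * K + 1) * x) * (3 * K + 1))) hcont ?_ ?_ ?_ ?_ ?_ ⟨hT, le_rfl⟩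
  · intro x hx r hr
    have hgx := hg0 x ⟨hx.1, hx.2.le⟩
    have hc : ContinuousAt (fun B => K * (1 + Real.log (1 + B)) * B) (g x) := by
      have : 1 + g x ≠ 0 := by linarith
      fun_prop (disch := assumption)
    obtain ⟨B, hB1, hB2⟩ : ∃ B, g x < B ∧ K * (1 + Real.log (1 + B)) * B < r := by
      have h1 : ∀ᶠ B in 𝓝[>] (g x), K * (1 + Real.log (1 + B)) * B < r :=
        (hc.eventually (gt_mem_nhds hr)).filter_mono nhdsWithin_le_nhds
      exact (h1.and self_mem_nhdsWithin).exists.imp fun B hB => ⟨hB.2, hB.1⟩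
    have h2 : ∀ᶠ z in 𝓝[≥] x, g z < B ∧ z ∈ Set.Icc 0 T := by
      have hI : Set.Icc 0 T ∈ 𝓝[≥] x :=
        mem_of_superset (Ico_mem_nhdsGE hx.2) fun z hz => ⟨hx.1.trans hz.1, hz.2.le⟩
      have h3 := (hcont x ⟨hx.1, hx.2.le⟩).eventually (gt_mem_nhds hB1)
      rw [eventually_iff] at h3 ⊢
      have h4 : 𝓝[≥] x ≤ 𝓝[Set.Icc 0 T] x :=
        le_inf nhdsWithin_le_nhds (le_principal_iff.2 hI)
      exact inter_mem (h4 h3) hI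
    obtain ⟨w, hw, hwI⟩ := mem_nhdsGE_iff_exists_Ico_subset.1 h2
    have h5 : ∀ᶠ z in 𝓝[>] x, slope g x z < r := by
      filter_upwards [Ioo_mem_nhdsGT hw] with z hz
      have hzI : ∀ τ ∈ Set.Icc x z, g τ < B ∧ τ ∈ Set.Icc 0 T := fun τ hτ =>
        hwI ⟨hτ.1, hτ.2.trans_lt hz.2⟩
      have h6 := hlip x ⟨hx.1, hx.2.le⟩ z (hzI z ⟨hz.1.le, le_rfl⟩).2 hz.1.le B
        fun τ hτ => (hzI τ hτ).1.le
      rw [slope_def_field]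
      refine lt_of_le_of_lt ?_ hB2
      rw [div_le_iff₀ (sub_pos.2 hz.1)]
      exact (le_abs_self _).trans h6
    exact h5.frequently
  · have h1 := Real.add_one_le_exp (g 0)
    have h2 := Real.add_one_le_exp (Real.exp (g 0))
    simp only [mul_zero, add_zero]
    linarith
  · fun_prop
  · intro x _
    have h1 : HasDerivAt (fun x => g 0 + (3 * K + 1) * x) (3 * K + 1) x := by
      simpa using ((hasDerivAt_id x).const_mul (3 * K + 1)).const_add (g 0)
    exact h1.exp.exp.hasDerivWithinAt
  · intro x hx hgx
    have hexp : 0 ≤ g 0 + (3 * K + 1) * x := by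
      have := hg0 0 h0T
      have := hx.1
      positivity
    set E := Real.exp (g 0 + (3 * K + 1) * x)
    have hE : 1 ≤ E := Real.one_le_exp hexp
    rw [hgx]
    have hb2 : 2 ≤ Real.exp E := by linarith [Real.add_one_le_exp E]
    have hlog : Real.log (1 + Real.exp E) ≤ 2 * E := by
      calc Real.log (1 + Real.exp E) ≤ Real.log (Real.exp E ^ 2) :=
            Real.log_le_log (by positivity) (by nlinarith)
        _ = 2 * E := by rw [Real.log_pow, Real.log_exp]; norm_num
    have h3 : K * (1 + Real.log (1 + Real.exp E)) < E * (3 * K + 1) := by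
      have := mul_le_mul_of_nonneg_left hlog hK
      nlinarith [mul_nonneg hK (sub_nonneg.2 hE)]
    nlinarith

/-- The growth bound appearing in `le_exp_exp_of_log_growth`. -/
def growthBound (A m r : ℝ) : ℝ := Real.exp (Real.exp (m + (3 * (A * (1 + m)) + 1) * r))

theorem growthBound_mono {A m m' r r' : ℝ} (hA : 0 ≤ A) (hm : 0 ≤ m) (hmm : m ≤ m')
    (hr : 0 ≤ r) (hrr : r ≤ r') : growthBound A m r ≤ growthBound A m' r' := by
  refine Real.exp_le_exp.2 (Real.exp_le_exp.2 ?_)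
  have hm' := hm.trans hmm
  have : 0 ≤ 3 * (A * (1 + m')) + 1 := by positivity
  gcongr

section LocallyBounded

variable {y : ℝ → ℝ} {A : ℝ}

/-- Quantitative growth between two points of an interval on which `y` is bounded. -/
theorem le_growthBound_of_bounded (hA : 0 ≤ A) (hy0 : ∀ t, 0 ≤ y t)
    (hlip : ∀ c d B, (∀ τ ∈ Set.uIcc c d, y τ ≤ B) → ∀ x ∈ Set.uIcc c d, ∀ x' ∈ Set.uIcc c d,
      ∀ B', (∀ τ ∈ Set.uIcc x x', y τ ≤ B') →
        |y x' - y x| ≤ A * (1 + y c) * (1 + Real.log (1 + B')) * B' * |x' - x|)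
    {c d B : ℝ} (hB : ∀ τ ∈ Set.uIcc c d, y τ ≤ B) : y d ≤ growthBound A (y c) |d - c| := by
  have hK : 0 ≤ A * (1 + y c) := mul_nonneg hA (by linarith [hy0 c])
  rcases le_total c d with hcd | hcd
  · have hm : ∀ x ∈ Set.Icc 0 (d - c), c + x ∈ Set.uIcc c d := fun x hx => by
      rw [Set.uIcc_of_le hcd]; constructor <;> linarith [hx.1, hx.2]
    have := le_exp_exp_of_log_growth (g := fun x => y (c + x)) (T := d - c) (B₀ := B)
      (sub_nonneg.2 hcd) hK (fun x _ => hy0 _) (fun x hx => hB _ (hm x hx))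
      (fun x hx x' hx' hxx' B' hB' => by
        have h := hlip c d B hB (c + x) (hm x hx) (c + x') (hm x' hx') B' fun τ hτ => by
          rw [Set.uIcc_of_le (by linarith)] at hτ
          simpa using hB' (τ - c) ⟨by linarith [hτ.1], by linarith [hτ.2]⟩
        rwa [add_sub_add_left_eq_sub, abs_of_nonneg (sub_nonneg.2 hxx')] at h)
    rw [abs_of_nonneg (sub_nonneg.2 hcd)]
    simpa [growthBound] using this
  · have hm : ∀ x ∈ Set.Icc 0 (c - d), c - x ∈ Set.uIcc c d := fun x hx => by
      rw [Set.uIcc_of_ge hcd]; constructor <;> linarith [hx.1, hx.2]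
    have := le_exp_exp_of_log_growth (g := fun x => y (c - x)) (T := c - d) (B₀ := B)
      (sub_nonneg.2 hcd) hK (fun x _ => hy0 _) (fun x hx => hB _ (hm x hx))
      (fun x hx x' hx' hxx' B' hB' => by
        have h := hlip c d B hB (c - x) (hm x hx) (c - x') (hm x' hx') B' fun τ hτ => by
          rw [Set.uIcc_of_ge (by linarith)] at hτ
          simpa using hB' (c - τ) ⟨by linarith [hτ.2], by linarith [hτ.1]⟩
        rwa [sub_sub_sub_cancel_left, abs_sub_comm x, abs_of_nonneg (sub_nonneg.2 hxx')] at h)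
    rw [abs_sub_comm, abs_of_nonneg (sub_nonneg.2 hcd)]
    simpa [growthBound] using this

theorem exists_bound_uIcc {a t : ℝ}
    (h : ∀ τ ∈ Set.uIcc a t, ∃ M, ∀ᶠ x in 𝓝 τ, y x ≤ M) :
    ∃ B, ∀ τ ∈ Set.uIcc a t, y τ ≤ B := by
  refine isCompact_uIcc.induction_on (p := fun s => ∃ B, ∀ τ ∈ s, y τ ≤ B) ⟨0, by simp⟩
    (fun s s' hss ⟨B, hB⟩ => ⟨B, fun τ hτ => hB τ (hss hτ)⟩) ?_ ?_
  · rintro s s' ⟨B, hB⟩ ⟨B', hB'⟩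
    exact ⟨max B B', fun τ hτ => hτ.elim (fun h => (hB τ h).trans (le_max_left _ _))
      fun h => (hB' τ h).trans (le_max_right _ _)⟩
  · intro τ hτ
    obtain ⟨M, hM⟩ := h τ hτ
    exact ⟨_, mem_nhdsWithin_of_mem_nhds hM, M, fun x hx => hx⟩

/-- The growth estimate extends to an endpoint where local boundedness is not known. -/
theorem le_growthBound_of_locally_bounded (hA : 0 ≤ A) (hy0 : ∀ t, 0 ≤ y t)
    (hlip : ∀ c d B, (∀ τ ∈ Set.uIcc c d, y τ ≤ B) → ∀ x ∈ Set.uIcc c d, ∀ x' ∈ Set.uIcc c d,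
      ∀ B', (∀ τ ∈ Set.uIcc x x', y τ ≤ B') →
        |y x' - y x| ≤ A * (1 + y c) * (1 + Real.log (1 + B')) * B' * |x' - x|)
    {a t : ℝ} (h : ∀ τ ∈ Set.uIcc a t, τ ≠ a → ∃ M, ∀ᶠ x in 𝓝 τ, y x ≤ M) :
    y t ≤ growthBound A (y a) |t - a| := by
  refine le_growthBound_of_bounded hA hy0 hlip
    (B := max (y a) (growthBound A (y t) |a - t|)) fun τ hτ => ?_
  by_cases hτa : τ = a
  · exact hτa ▸ le_max_left _ _
  refine le_trans ?_ (le_max_right _ _)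
  obtain ⟨B, hB⟩ := exists_bound_uIcc (a := t) (t := τ) fun x hx => by
    rw [Set.uIcc_comm] at hx
    refine h x (Set.uIcc_subset_uIcc_right hτ hx) ?_
    rintro rfl
    apply hτa
    rcases Set.mem_uIcc.1 hτ with h1 | h1 <;> rcases Set.mem_uIcc.1 hx with h2 | h2 <;> linarith
  refine (le_growthBound_of_bounded hA hy0 hlip hB).trans
    (growthBound_mono hA (hy0 t) le_rfl (abs_nonneg _) ?_)
  rw [abs_sub_comm, abs_sub_comm a]
  exact Set.abs_sub_right_of_mem_uIcc hτ

/-- A pointwise finite, lower semicontinuous function with almost linear growth rate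
is locally bounded. -/
theorem locally_bounded_of_log_growth (hA : 0 ≤ A) (hy0 : ∀ t, 0 ≤ y t)
    (hcl : ∀ M, IsClosed {t | y t ≤ M})
    (hlip : ∀ c d B, (∀ τ ∈ Set.uIcc c d, y τ ≤ B) → ∀ x ∈ Set.uIcc c d, ∀ x' ∈ Set.uIcc c d,
      ∀ B', (∀ τ ∈ Set.uIcc x x', y τ ≤ B') →
        |y x' - y x| ≤ A * (1 + y c) * (1 + Real.log (1 + B')) * B' * |x' - x|) (t : ℝ) :
    ∃ M, ∀ᶠ x in 𝓝 t, y x ≤ M := by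
  by_contra ht
  set F : Set ℝ := {t | ¬ ∃ M, ∀ᶠ x in 𝓝 t, y x ≤ M} with hF
  have hFc : IsClosed F := by
    rw [← isOpen_compl_iff, isOpen_iff_mem_nhds]
    intro x hx
    obtain ⟨M, hM⟩ := not_not.1 hx
    filter_upwards [eventually_eventually_nhds.2 hM] with z hz
    exact not_not.2 ⟨M, hz⟩
  have : Nonempty F := ⟨⟨t, ht⟩⟩
  have : CompleteSpace F := hFc.completeSpace_coe
  obtain ⟨M, t₀, ht₀⟩ := nonempty_interior_of_iUnion_of_closed (X := F)
    (f := fun M : ℕ => {x : F | y x ≤ M}) (fun M => (hcl M).preimage continuous_subtype_val)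
    (Set.eq_univ_of_forall fun x => Set.mem_iUnion.2 (exists_nat_ge (y x)))
  obtain ⟨V, hV, hVM⟩ := mem_nhds_subtype _ _ _ |>.1 (mem_interior_iff_mem_nhds.1 ht₀)
  obtain ⟨ε, hε, hball⟩ := Metric.mem_nhds_iff.1 hV
  have hM : ∀ x ∈ F, |x - t₀| < ε → y x ≤ M := fun x hx hxε =>
    hVM (a := ⟨x, hx⟩) (hball (by simpa [Real.dist_eq] using hxε))
  refine t₀.2 ⟨growthBound A M ε, ?_⟩
  filter_upwards [Metric.ball_mem_nhds (t₀ : ℝ) hε] with τ hτ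
  rw [Metric.mem_ball, Real.dist_eq] at hτ
  obtain ⟨a, ⟨haF, ha⟩, hmin⟩ := ((isCompact_uIcc (a := (t₀ : ℝ)) (b := τ)).inter_left
    hFc).exists_isMinOn ⟨t₀, t₀.2, Set.left_mem_uIcc⟩
      (f := fun x => |τ - x|) (by fun_prop)
  have ha1 : |a - t₀| < ε := (Set.abs_sub_left_of_mem_uIcc ha).trans_lt hτ
  have ha2 : |τ - a| ≤ ε := (Set.abs_sub_right_of_mem_uIcc ha).trans hτ.le
  refine (le_growthBound_of_locally_bounded hA hy0 hlip (a := a) fun x hx hxa => ?_).trans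
    (growthBound_mono hA (hy0 a) (hM a haF ha1) (abs_nonneg _) ha2)
  by_contra hxF
  have h1 : |τ - a| ≤ |τ - x| := hmin ⟨hxF, Set.uIcc_subset_uIcc_right ha hx⟩
  apply hxa
  rcases Set.mem_uIcc.1 hx with ⟨h2, h3⟩ | ⟨h2, h3⟩
  · rw [abs_of_nonneg (by linarith), abs_of_nonneg (by linarith)] at h1; linarith
  · rw [abs_of_nonpos (by linarith), abs_of_nonpos (by linarith)] at h1; linarith

end LocallyBounded

section LocalBound

variable {α σ : ℝ} {u : ℝ → ℕ → ℂ}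

theorem SolvesSzego.continuous_coeff (hsol : SolvesSzego α u) (n : ℕ) :
    Continuous fun t => u t n :=
  continuous_iff_continuousAt.2 fun t => (hsol n t).continuousAt

/-- The weighted norm of a solution is locally bounded in time. -/
theorem SolvesSzego.wnorm_locally_bounded (hsol : SolvesSzego α u) (h0 : 1 / 2 < σ) (h1 : σ ≤ 1)
    (hfin : ∀ t, FinWnorm σ (u t)) (t : ℝ) : ∃ M, ∀ᶠ x in 𝓝 t, wnorm σ (u x) ≤ M := by
  obtain ⟨C, hC0, hC⟩ := exists_sq_tsum_norm_le_log h0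
  refine locally_bounded_of_log_growth (A := 8 * C) (by positivity)
    (fun t => wnorm_nonneg _ _) (fun M => ?_) (fun c d B hB x hx x' hx' B' hB' => ?_) t
  · have : {t | wnorm σ (u t) ≤ M} =
        ⋂ s : Finset ℕ, {t | ∑ n ∈ s, wt σ n ^ 2 * ‖u t n‖ ^ 2 ≤ M} := by
      ext t
      simp only [Set.mem_ofPred_eq, Set.mem_iInter]
      exact ⟨fun h s => ((hfin t).sum_le_tsum s fun n _ => by positivity).trans h,
        fun h => (hfin t).tsum_le_of_sum_le h⟩
    rw [this]
    exact isClosed_iInter fun s => isClosed_le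
      (continuous_finsetSum _ fun n _ => ((hsol.continuous_coeff n).norm.pow 2).const_mul _)
      continuous_const
  · have h := hsol.abs_wnorm_sub_le h0 h1 hfin hC0 hC hB'
    have hE : wnorm (1 / 2) (u x) = wnorm (1 / 2) (u c) :=
      hsol.wnorm_half_eq h0 h1 hfin fun τ hτ => hB τ (Set.uIcc_subset_uIcc_left hx hτ)
    have hB'0 : 0 ≤ B' := (wnorm_nonneg _ _).trans (hB' x Set.left_mem_uIcc)
    have hlog : 0 ≤ Real.log (1 + B') := Real.log_nonneg (by linarith)
    rw [hE] at h
    have := wnorm_mono h0.le (hfin c)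
    refine h.trans ?_
    gcongr

theorem FinWnorm.cubic_l1 (h0 : 1 / 2 < σ) (h1 : σ ≤ 1) {v : ℕ → ℂ} (hv : FinWnorm σ v)
    {M : ℝ} (hM : wnorm σ v ≤ M) :
    (Summable fun n => wt ((2 * σ - 1) / 4) n * ‖_root_.cubic v n‖) ∧
      ∑' n, wt ((2 * σ - 1) / 4) n * ‖_root_.cubic v n‖
        ≤ 2 * (1 + (∑' n, wt (-(σ + 1 / 2)) n) * M) ^ 3 := by
  have hs := hv.l1 h0
  have hc := summable_weight_cubic (u := v) (fun n => (wt_pos _ _).le)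
    (wt_add_le (by linarith) (by linarith)) (hv.summable_norm h0) hs.1
  refine ⟨hc.1, hc.2.trans ?_⟩
  have hW := hv.tsum_norm_le h0
  set K := ∑' n, wt (-(σ + 1 / 2)) n
  set P := ∑' n, wt ((2 * σ - 1) / 4) n * ‖v n‖
  have hK : 0 ≤ K := tsum_nonneg fun _ => (wt_pos _ _).le
  have hP : P ≤ 1 + K * M := by
    have := mul_le_mul_of_nonneg_left hM hK
    nlinarith [hs.2, sq_nonneg (P - 1)]
  have hW0 : 0 ≤ ∑' n, ‖v n‖ := tsum_nonneg fun _ => norm_nonneg _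
  have hW' := hW.trans hP
  have hP0 := hW0.trans hW
  calc 2 * (∑' n, ‖v n‖) ^ 2 * P ≤ 2 * (1 + K * M) ^ 2 * (1 + K * M) := by
        have := hP0.trans hP
        gcongr
    _ = _ := by ring

/-- The time derivative of the coefficients of a solution. -/
def szegoField (α : ℝ) (v : ℕ → ℂ) (n : ℕ) : ℂ :=
  -Complex.I * (cubic v n + (α : ℂ) * v 0 * oneSeq n)

theorem szegoField_add_one (α : ℝ) (v : ℕ → ℂ) (n : ℕ) :
    szegoField α v (n + 1) = -Complex.I * cubic v (n + 1) := by
  simp [szegoField, oneSeq]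

theorem FinWnorm.summable_norm_cubic (h0 : 1 / 2 < σ) (h1 : σ ≤ 1) {v : ℕ → ℂ}
    (hv : FinWnorm σ v) : Summable fun n => ‖_root_.cubic v n‖ :=
  (tsum_tail_le (by linarith) (fun _ => norm_nonneg _) (hv.cubic_l1 h0 h1 le_rfl).1 0).1

theorem FinWnorm.summable_norm_szegoField (h0 : 1 / 2 < σ) (h1 : σ ≤ 1) {v : ℕ → ℂ}
    (hv : FinWnorm σ v) (α : ℝ) : Summable fun n => ‖szegoField α v n‖ := by
  rw [← summable_nat_add_iff 1]
  simpa [szegoField_add_one] using (summable_nat_add_iff 1).2 (hv.summable_norm_cubic h0 h1)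

theorem summable_smul_of_norm_le_one {E : Type*} [NormedAddCommGroup E] [NormedSpace ℂ E]
    [CompleteSpace E] {g : ℕ → E} (hg : ∀ n, ‖g n‖ ≤ 1) {c : ℕ → ℂ} (hc : Summable fun n => ‖c n‖) :
    Summable fun n => c n • g n :=
  Summable.of_norm_bounded hc fun n => by
    rw [norm_smul]; exact mul_le_of_le_one_right (norm_nonneg _) (hg n)

/-- Linear superpositions of the coefficients of a solution may be differentiated termwise. -/
theorem SolvesSzego.hasDerivAt_tsum_smul {E : Type*} [NormedAddCommGroup E] [NormedSpace ℂ E]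
    [CompleteSpace E] (hsol : SolvesSzego α u) (h0 : 1 / 2 < σ) (h1 : σ ≤ 1)
    (hfin : ∀ t, FinWnorm σ (u t)) {g : ℕ → E} (hg : ∀ n, ‖g n‖ ≤ 1) (t : ℝ) :
    HasDerivAt (fun τ => ∑' n, u τ n • g n) (∑' n, szegoField α (u t) n • g n) t := by
  obtain ⟨M, hM⟩ := hsol.wnorm_locally_bounded h0 h1 hfin t
  obtain ⟨U, hU, hUo, htU⟩ := eventually_nhds_iff.1 hM
  have hs : ∀ τ, Summable fun n => szegoField α (u τ) n • g n := fun τ =>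
    summable_smul_of_norm_le_one hg ((hfin τ).summable_norm_szegoField h0 h1 α)
  refine hasDerivAt_of_tendstoUniformlyOn (l := atTop) (s := U)
    (f := fun N τ => ∑ n ∈ Finset.range N, u τ n • g n)
    (f' := fun N τ => ∑ n ∈ Finset.range N, szegoField α (u τ) n • g n)
    (g' := fun τ => ∑' n, szegoField α (u τ) n • g n) hUo ?_ ?_ ?_ htU
  · set R := 2 * (1 + (∑' n, wt (-(σ + 1 / 2)) n) * M) ^ 3
    have hlim : Tendsto (fun N => wt (-((2 * σ - 1) / 4)) N * R) atTop (𝓝 0) := by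
      have := (tendsto_wt_neg (by linarith : 0 < (2 * σ - 1) / 4)).mul_const R
      rwa [zero_mul] at this
    rw [Metric.tendstoUniformlyOn_iff]
    intro ε hε
    filter_upwards [hlim.eventually (gt_mem_nhds hε), eventually_ge_atTop 1] with N hN hN1 τ hτ
    refine lt_of_le_of_lt ?_ hN
    have hc := (hfin τ).cubic_l1 h0 h1 (hU τ hτ)
    have htail := tsum_tail_le (by linarith : 0 ≤ (2 * σ - 1) / 4) (fun _ => norm_nonneg _) hc.1 N
    rw [dist_eq_norm, ← (hs τ).sum_add_tsum_nat_add N, add_sub_cancel_left]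
    calc _ ≤ ∑' n, ‖cubic (u τ) (n + N)‖ := by
          refine tsum_of_norm_bounded ((summable_nat_add_iff N).2 htail.1).hasSum fun n => ?_
          obtain ⟨m, hm⟩ : ∃ m, n + N = m + 1 := ⟨n + N - 1, by omega⟩
          rw [hm, szegoField_add_one, norm_smul]
          simpa using mul_le_of_le_one_right (norm_nonneg (cubic (u τ) (m + 1))) (hg (m + 1))
      _ ≤ _ := htail.2
      _ ≤ _ := mul_le_mul_of_nonneg_left hc.2 (wt_pos _ _).le
  · exact Eventually.of_forall fun N τ _ =>
      HasDerivAt.fun_sum fun n _ => (hsol n τ).smul_const (g n)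
  · exact fun τ _ => (summable_smul_of_norm_le_one hg
      ((hfin τ).summable_norm h0)).hasSum.tendsto_sum_nat

end LocalBound

section Shift

/-- The standard basis vectors of `Hardy`. -/
def basisVec (n : ℕ) : Hardy := lp.single 2 n 1

theorem basisVec_apply (n k : ℕ) : (basisVec n : ℕ → ℂ) k = if k = n then 1 else 0 := by
  rw [basisVec, lp.single_apply, Pi.single_apply]

theorem norm_basisVec (n : ℕ) : ‖basisVec n‖ = 1 := by
  rw [basisVec, lp.norm_single (by norm_num), norm_one]

theorem inner_basisVec_left (n : ℕ) (x : Hardy) : inner ℂ (basisVec n) x = x n := by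
  rw [basisVec, lp.inner_single_left]; simp

theorem inner_basisVec_right (n : ℕ) (x : Hardy) : inner ℂ x (basisVec n) = conj (x n) := by
  rw [← inner_conj_symm, inner_basisVec_left]

theorem Hardy.hasSum_sq (x : Hardy) : HasSum (fun n => ‖x n‖ ^ 2) (‖x‖ ^ 2) := by
  simpa only [ENNReal.toReal_ofNat, Real.rpow_two] using lp.hasSum_norm (by norm_num) x

theorem Hardy.hasSum_basisVec (x : Hardy) : HasSum (fun n => x n • basisVec n) x := by
  refine (lp.hasSum_single (by norm_num) x).congr_fun ?_
  intro n
  rw [basisVec, ← lp.single_smul, smul_eq_mul, mul_one]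

theorem Hardy.clm_ext {E : Type*} [NormedAddCommGroup E] [NormedSpace ℂ E]
    {A B : Hardy →L[ℂ] E} (h : ∀ n, A (basisVec n) = B (basisVec n)) : A = B := by
  ext1 x
  have hA := x.hasSum_basisVec.mapL A
  have hB := x.hasSum_basisVec.mapL B
  simp only [map_smul, h] at hA hB
  exact hA.unique hB

theorem memlp_two_iff {f : ℕ → ℂ} : Memℓp f 2 ↔ Summable fun n => ‖f n‖ ^ 2 := by
  rw [memℓp_gen_iff (by norm_num)]
  simp only [ENNReal.toReal_ofNat, Real.rpow_two]

theorem Hardy.norm_le_of_sum_sq_le {x : Hardy} {C : ℝ} (hC : 0 ≤ C)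
    (h : ∑' n, ‖x n‖ ^ 2 ≤ C ^ 2) : ‖x‖ ≤ C := by
  rw [x.hasSum_sq.tsum_eq] at h
  exact le_of_sq_le_sq h hC

/-- The backward shift. -/
def bshift : Hardy →L[ℂ] Hardy :=
  LinearMap.mkContinuous
    { toFun := fun x => ⟨fun n => x (n + 1), memlp_two_iff.2
        ((summable_nat_add_iff 1).2 x.hasSum_sq.summable)⟩
      map_add' := fun _ _ => rfl
      map_smul' := fun _ _ => rfl } 1 fun x => by
    rw [one_mul]
    refine Hardy.norm_le_of_sum_sq_le (norm_nonneg _) ?_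
    rw [← x.hasSum_sq.tsum_eq, x.hasSum_sq.summable.tsum_eq_zero_add]
    exact le_add_of_nonneg_left (sq_nonneg _)

theorem bshift_apply (x : Hardy) (n : ℕ) : bshift x n = x (n + 1) := rfl

theorem norm_bshift_le : ‖bshift‖ ≤ 1 := LinearMap.mkContinuous_norm_le _ zero_le_one _

theorem bshift_pow_apply (j : ℕ) (x : Hardy) (n : ℕ) : (bshift ^ j) x n = x (n + j) := by
  induction j generalizing n with
  | zero => rfl
  | succ j ih =>
    rw [pow_succ', mul_apply_eq_comp, bshift_apply, ih]
    rw [add_right_comm, add_assoc]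

theorem bshift_pow_basisVec (j n : ℕ) :
    (bshift ^ j) (basisVec n) = if j ≤ n then basisVec (n - j) else 0 := by
  ext k
  rw [bshift_pow_apply, basisVec_apply]
  split_ifs with h1 h2 h2
  · rw [basisVec_apply, if_pos (by omega)]
  · omega
  · rw [basisVec_apply, if_neg (by omega)]
  · rfl

theorem star_bshift_basisVec (n : ℕ) : (star bshift) (basisVec n) = basisVec (n + 1) := by
  ext k
  rw [← inner_basisVec_left, ContinuousLinearMap.star_eq_adjoint,
    ContinuousLinearMap.adjoint_inner_right, inner_basisVec_right, bshift_apply,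
    basisVec_apply, basisVec_apply]
  by_cases h : n + 1 = k
  · simp [h]
  · simp [h, Ne.symm h]

theorem star_bshift_pow_basisVec (j n : ℕ) :
    (star bshift ^ j) (basisVec n) = basisVec (n + j) := by
  induction j with
  | zero => rfl
  | succ j ih =>
    rw [pow_succ', mul_apply_eq_comp, ih, star_bshift_basisVec]; rfl

theorem bshift_star_bshift : bshift * star bshift = 1 := by
  refine Hardy.clm_ext fun n => ?_
  rw [mul_apply_eq_comp, star_bshift_basisVec]
  have := bshift_pow_basisVec 1 (n + 1)
  simpa using this

theorem Hardy.eq_add_star_bshift (x : Hardy) :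
    x = x 0 • basisVec 0 + star bshift (bshift x) := by
  suffices h : (1 : Hardy →L[ℂ] Hardy) =
      InnerProductSpace.rankOne ℂ (basisVec 0) (basisVec 0) + star bshift * bshift by
    have := congrArg (fun A : Hardy →L[ℂ] Hardy => A x) h
    simpa [inner_basisVec_left] using this
  refine Hardy.clm_ext fun n => ?_
  cases n with
  | zero =>
    have := bshift_pow_basisVec 1 0
    rw [pow_one] at this
    simp [this, norm_basisVec]
  | succ n =>
    have := bshift_pow_basisVec 1 (n + 1)
    rw [pow_one] at this
    simp [this, inner_basisVec_left, basisVec_apply, star_bshift_basisVec]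

/-- The Hankel matrix with ones on the antidiagonal `k + l + 1 = n`. -/
def antidiag (n : ℕ) : Hardy →L[ℂ] Hardy :=
  ∑ k ∈ Finset.range n, InnerProductSpace.rankOne ℂ (basisVec k) (basisVec (n - 1 - k))

theorem antidiag_apply (n : ℕ) (x : Hardy) (k : ℕ) :
    antidiag n x k = if k < n then x (n - 1 - k) else 0 := by
  rw [antidiag, sum_apply, lp.coeFn_sum, Finset.sum_apply]
  simp only [InnerProductSpace.rankOne_apply, inner_basisVec_left, lp.coeFn_smul, Pi.smul_apply,
    basisVec_apply, smul_eq_mul, mul_ite, mul_one, mul_zero, Finset.sum_ite_eq, Finset.mem_range]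

theorem norm_antidiag_le (n : ℕ) : ‖antidiag n‖ ≤ 1 := by
  refine ContinuousLinearMap.opNorm_le_bound _ zero_le_one fun x => ?_
  rw [one_mul]
  refine Hardy.norm_le_of_sum_sq_le (norm_nonneg _) ?_
  rw [tsum_eq_sum (s := Finset.range n) fun k hk => by
    rw [antidiag_apply, if_neg (by simpa using hk)]; simp]
  rw [← x.hasSum_sq.tsum_eq]
  calc _ = ∑ k ∈ Finset.range n, ‖x (n - 1 - k)‖ ^ 2 := Finset.sum_congr rfl fun k hk => by
        rw [antidiag_apply, if_pos (by simpa using hk)]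
    _ = ∑ k ∈ Finset.range n, ‖x k‖ ^ 2 := Finset.sum_range_reflect (fun k => ‖x k‖ ^ 2) n
    _ ≤ _ := x.hasSum_sq.summable.sum_le_tsum _ fun _ _ => sq_nonneg _

theorem antidiag_basisVec (n l : ℕ) : antidiag n (basisVec l) = (bshift ^ (l + 1)) (basisVec n) := by
  ext k
  rw [antidiag_apply, bshift_pow_apply, basisVec_apply, basisVec_apply]
  split_ifs <;> first | rfl | omega

theorem isCompactOperator_rankOne (x y : Hardy) :
    IsCompactOperator (InnerProductSpace.rankOne ℂ x y) := by
  rw [InnerProductSpace.rankOne_def']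
  exact (isCompactOperator_of_locallyCompactSpace_rng
    (ContinuousLinearMap.toSpanSingleton ℂ x)).comp_clm (innerSL ℂ y)

theorem isCompactOperator_antidiag (n : ℕ) : IsCompactOperator (antidiag n) := by
  exact Finset.sum_induction _ (fun A : Hardy →L[ℂ] Hardy => IsCompactOperator A)
    (fun _ _ => IsCompactOperator.add) isCompactOperator_zero
    fun _ _ => isCompactOperator_rankOne _ _

end Shift

section Superposition

variable {v : ℕ → ℂ}

/-- The symbol `∑ v n zⁿ` as a vector. -/
def symVec (v : ℕ → ℂ) : Hardy := ∑' n, v n • basisVec n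

/-- The multiplication operator by `∑ v n zⁿ`. -/
def mulOp (v : ℕ → ℂ) : Hardy →L[ℂ] Hardy := ∑' n, v n • star bshift ^ n

/-- The superposition of the powers of the backward shift with coefficients `v`. -/
def backOp (v : ℕ → ℂ) : Hardy →L[ℂ] Hardy := ∑' n, v n • bshift ^ n

/-- The linear operator with Hankel matrix `v (k + l + 1)`. -/
def hankelOp (v : ℕ → ℂ) : Hardy →L[ℂ] Hardy := ∑' n, v n • antidiag n

theorem norm_bshift_pow_le (n : ℕ) : ‖bshift ^ n‖ ≤ 1 := by
  induction n with
  | zero => exact ContinuousLinearMap.norm_id_le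
  | succ n ih =>
    rw [pow_succ]
    exact (norm_mul_le _ _).trans (mul_le_one₀ ih (norm_nonneg _) norm_bshift_le)

theorem norm_star_bshift_pow_le (n : ℕ) : ‖star bshift ^ n‖ ≤ 1 := by
  rw [← star_pow, ContinuousLinearMap.star_eq_adjoint, LinearIsometryEquiv.norm_map]
  exact norm_bshift_pow_le n

theorem hasSum_symVec (hv : Summable fun n => ‖v n‖) :
    HasSum (fun n => v n • basisVec n) (symVec v) :=
  (summable_smul_of_norm_le_one (fun n => (norm_basisVec n).le) hv).hasSum

theorem hasSum_mulOp (hv : Summable fun n => ‖v n‖) :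
    HasSum (fun n => v n • star bshift ^ n) (mulOp v) :=
  (summable_smul_of_norm_le_one norm_star_bshift_pow_le hv).hasSum

theorem hasSum_backOp (hv : Summable fun n => ‖v n‖) :
    HasSum (fun n => v n • bshift ^ n) (backOp v) :=
  (summable_smul_of_norm_le_one norm_bshift_pow_le hv).hasSum

theorem hasSum_hankelOp (hv : Summable fun n => ‖v n‖) :
    HasSum (fun n => v n • antidiag n) (hankelOp v) :=
  (summable_smul_of_norm_le_one norm_antidiag_le hv).hasSum

theorem hasSum_smul_apply {c : ℕ → ℂ} {g : ℕ → Hardy →L[ℂ] Hardy} {A : Hardy →L[ℂ] Hardy}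
    (h : HasSum (fun n => c n • g n) A) (x : Hardy) : HasSum (fun n => c n • g n x) (A x) :=
  h.mapL (ContinuousLinearMap.apply ℂ Hardy x)

theorem hasSum_star_smul {c : ℕ → ℂ} {g : ℕ → Hardy →L[ℂ] Hardy} {A : Hardy →L[ℂ] Hardy}
    (h : HasSum (fun n => c n • g n) A) : HasSum (fun n => conj (c n) • star (g n)) (star A) := by
  simpa only [star_smul, Complex.star_def] using h.star

theorem symVec_apply (hv : Summable fun n => ‖v n‖) (n : ℕ) : symVec v n = v n := by
  have h := (hasSum_symVec hv).mapL (innerSL ℂ (basisVec n))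
  refine (inner_basisVec_left n _).symm.trans (h.unique ((hasSum_ite_eq n (v n)).congr_fun ?_))
  intro k
  rw [map_smul, innerSL_apply_apply, inner_basisVec_left, basisVec_apply]
  by_cases hk : k = n
  · simp [hk]
  · simp [hk, Ne.symm hk]

theorem mulOp_basisVec_zero (hv : Summable fun n => ‖v n‖) : mulOp v (basisVec 0) = symVec v := by
  refine (hasSum_smul_apply (hasSum_mulOp hv) _).unique ?_
  simpa only [star_bshift_pow_basisVec, zero_add] using hasSum_symVec hv

theorem hankelOp_basisVec (hv : Summable fun n => ‖v n‖) (l : ℕ) :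
    hankelOp v (basisVec l) = (bshift ^ (l + 1)) (symVec v) := by
  refine (hasSum_smul_apply (hasSum_hankelOp hv) _).unique ?_
  simpa only [antidiag_basisVec, map_smul] using (hasSum_symVec hv).mapL (bshift ^ (l + 1))

theorem bshift_star_bshift_pow (n : ℕ) (x : Hardy) :
    bshift ((star bshift ^ n) x) =
      (star bshift ^ n) (bshift x) + x 0 • bshift (basisVec n) := by
  cases n with
  | zero =>
    have := bshift_pow_basisVec 1 0
    rw [pow_one] at this
    simp [this]
  | succ n =>
    have h1 : ∀ y, bshift (star bshift y) = y := fun y =>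
      congrArg (fun A : Hardy →L[ℂ] Hardy => A y) bshift_star_bshift
    have h2 : bshift (basisVec (n + 1)) = (star bshift ^ n) (basisVec 0) := by
      rw [star_bshift_pow_basisVec, zero_add, ← star_bshift_basisVec, h1]
    rw [h2, ← map_smul, pow_succ', mul_apply_eq_comp, h1, ← pow_succ', pow_succ,
      mul_apply_eq_comp, ← map_add, add_comm, ← x.eq_add_star_bshift]

theorem bshift_mulOp (hv : Summable fun n => ‖v n‖) (x : Hardy) :
    bshift (mulOp v x) = mulOp v (bshift x) + x 0 • bshift (symVec v) := by
  refine ((hasSum_smul_apply (hasSum_mulOp hv) x).mapL bshift).unique ?_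
  convert (hasSum_smul_apply (hasSum_mulOp hv) (bshift x)).add
    (((hasSum_symVec hv).mapL bshift).const_smul (x 0)) using 2 with n
  rw [map_smul, bshift_star_bshift_pow, smul_add, map_smul, smul_comm]

theorem commute_star_bshift_mulOp (v : ℕ → ℂ) :
    Commute (star bshift) (mulOp v) :=
  Commute.tsum_right _ fun n => ((Commute.refl _).pow_right n).smul_right _

theorem commute_bshift_star_mulOp (v : ℕ → ℂ) :
    Commute bshift (star (mulOp v)) := by
  simpa using (commute_star_bshift_mulOp v).star_star

theorem backOp_basisVec_zero (hv : Summable fun n => ‖v n‖) :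
    backOp v (basisVec 0) = v 0 • basisVec 0 := by
  refine (hasSum_smul_apply (hasSum_backOp hv) _).unique ?_
  convert hasSum_ite_eq 0 (v 0 • basisVec 0) using 2 with n
  rw [bshift_pow_basisVec]
  by_cases h : n = 0 <;> simp [h]

theorem backOp_basisVec_succ (hv : Summable fun n => ‖v n‖) (l : ℕ) :
    backOp v (basisVec (l + 1)) =
      star bshift (backOp v (basisVec l)) + v (l + 1) • basisVec 0 := by
  refine (hasSum_smul_apply (hasSum_backOp hv) _).unique ?_
  convert ((hasSum_smul_apply (hasSum_backOp hv) (basisVec l)).mapL (star bshift)).add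
    (hasSum_ite_eq (l + 1) (v (l + 1) • basisVec 0)) using 2 with n
  simp only [bshift_pow_basisVec, map_smul]
  rcases lt_trichotomy n (l + 1) with h | h | h
  · rw [if_pos h.le, if_pos (by omega), if_neg h.ne, star_bshift_basisVec, add_zero,
      show l + 1 - n = l - n + 1 by omega]
  · subst h; simp
  · rw [if_neg (by omega), if_neg (by omega), if_neg h.ne']; simp

theorem hankelOp_star_bshift (hv : Summable fun n => ‖v n‖) :
    hankelOp v * star bshift = bshift * hankelOp v := by
  refine Hardy.clm_ext fun l => ?_
  rw [mul_apply_eq_comp, mul_apply_eq_comp, star_bshift_basisVec, hankelOp_basisVec hv,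
    hankelOp_basisVec hv, pow_succ', mul_apply_eq_comp]

theorem hankelOp_star_bshift_pow (hv : Summable fun n => ‖v n‖) (n : ℕ) :
    hankelOp v * star bshift ^ n = bshift ^ n * hankelOp v :=
  SemiconjBy.pow_right (hankelOp_star_bshift hv) n

theorem hankelOp_star_backOp (hv : Summable fun n => ‖v n‖) :
    hankelOp v * star (backOp v) = star (mulOp v) * hankelOp v := by
  refine ((hasSum_star_smul (hasSum_backOp hv)).mul_left (hankelOp v)).unique ?_
  convert (hasSum_star_smul (hasSum_mulOp hv)).mul_right (hankelOp v) using 2 with n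
  rw [star_pow, star_pow, star_star, mul_smul_comm, smul_mul_assoc, hankelOp_star_bshift_pow hv]

theorem bshift_pow_mulOp_symVec (hv : Summable fun n => ‖v n‖) (l : ℕ) :
    (bshift ^ (l + 1)) (mulOp v (symVec v)) =
      mulOp v ((bshift ^ (l + 1)) (symVec v)) + hankelOp v (backOp v (basisVec l)) := by
  induction l with
  | zero =>
    rw [zero_add, pow_one, bshift_mulOp hv, backOp_basisVec_zero hv, map_smul,
      hankelOp_basisVec hv, symVec_apply hv, zero_add, pow_one]
  | succ l ih =>
    have h1 := congrArg (fun A : Hardy →L[ℂ] Hardy => A (backOp v (basisVec l)))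
      (hankelOp_star_bshift hv)
    simp only [mul_apply_eq_comp] at h1
    rw [pow_succ', mul_apply_eq_comp, ih, map_add, bshift_mulOp hv, bshift_pow_apply,
      symVec_apply hv, backOp_basisVec_succ hv, map_add, h1, map_smul, hankelOp_basisVec hv,
      zero_add, zero_add, pow_one, mul_apply_eq_comp]
    abel

/-- The positive operator `star (mulOp v) * mulOp v`, i.e. the Toeplitz operator of `|v|²`. -/
def toepOp (v : ℕ → ℂ) : Hardy →L[ℂ] Hardy := star (mulOp v) * mulOp v

theorem star_toepOp : star (toepOp v) = toepOp v := by simp [toepOp]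

theorem bshift_pow_toepOp_symVec (hv : Summable fun n => ‖v n‖) (l : ℕ) :
    (bshift ^ (l + 1)) (toepOp v (symVec v)) =
      (toepOp v * hankelOp v + hankelOp v * (star (backOp v) * backOp v)) (basisVec l) := by
  have h1 := congrArg (fun A : Hardy →L[ℂ] Hardy => A (mulOp v (symVec v)))
    ((commute_bshift_star_mulOp v).pow_left (l + 1)).eq
  have h2 := congrArg (fun A : Hardy →L[ℂ] Hardy => A (backOp v (basisVec l)))
    (hankelOp_star_backOp hv)
  simp only [mul_apply_eq_comp] at h1 h2
  rw [toepOp, mul_apply_eq_comp, h1, bshift_pow_mulOp_symVec hv, map_add, ← h2,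
    ← hankelOp_basisVec hv]
  rfl

theorem toepOp_basisVec_zero (hv : Summable fun n => ‖v n‖) :
    toepOp v (basisVec 0) =
      (hankelOp v * star (hankelOp v)) (basisVec 0) + conj (v 0) • symVec v := by
  have h1 := hasSum_smul_apply (hasSum_star_smul (hasSum_mulOp hv)) (symVec v)
  have h2 := ((star (hankelOp v)) (basisVec 0)).hasSum_basisVec.mapL (hankelOp v)
  have h3 : ∀ n, (star (hankelOp v)) (basisVec 0) n = conj (v (n + 1)) := fun n => by
    rw [← inner_basisVec_left, ContinuousLinearMap.star_eq_adjoint,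
      ContinuousLinearMap.adjoint_inner_right, inner_basisVec_right, hankelOp_basisVec hv,
      bshift_pow_apply, symVec_apply hv, zero_add]
  simp only [h3, map_smul, hankelOp_basisVec hv, star_pow, star_star] at h1 h2
  rw [toepOp, mul_apply_eq_comp, mulOp_basisVec_zero hv, ← h1.tsum_eq,
    h1.summable.tsum_eq_zero_add, mul_apply_eq_comp, ← h2.tsum_eq, add_comm]
  rfl

end Superposition

section LaxPair

variable {v : ℕ → ℂ}

theorem cubic_eq_toepOp (hv : Summable fun n => ‖v n‖) (n : ℕ) :
    cubic v n = toepOp v (symVec v) n := by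
  set φ : Hardy →L[ℂ] ℂ := innerSL ℂ (basisVec n)
  have hφ : ∀ x, φ x = x n := inner_basisVec_left n
  have hc : ∀ a b : ℕ, HasSum (fun c => v c * (basisVec (c + a) : ℕ → ℂ) (n + b))
      (φ ((bshift ^ b) ((star bshift ^ a) (symVec v)))) := fun a b => by
    have := (((hasSum_symVec hv).mapL (star bshift ^ a)).mapL (bshift ^ b)).mapL φ
    simp only [map_smul, star_bshift_pow_basisVec, smul_eq_mul] at this
    refine this.congr_fun fun c => ?_
    rw [hφ, bshift_pow_apply]
  have hb : ∀ a : ℕ, HasSum (fun b => conj (v b) * φ ((bshift ^ b) ((star bshift ^ a) (symVec v))))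
      (φ (star (mulOp v) ((star bshift ^ a) (symVec v)))) := fun a => by
    have := (hasSum_smul_apply (hasSum_star_smul (hasSum_mulOp hv))
      ((star bshift ^ a) (symVec v))).mapL φ
    simpa only [map_smul, star_pow, star_star, smul_eq_mul] using this
  have ha : HasSum (fun a => v a * φ (star (mulOp v) ((star bshift ^ a) (symVec v))))
      (φ (toepOp v (symVec v))) := by
    have := ((hasSum_smul_apply (hasSum_mulOp hv) (symVec v)).mapL (star (mulOp v))).mapL φ
    simp only [map_smul, smul_eq_mul] at this
    exact this
  have hcv : Summable fun n => ‖conj (v n)‖ := by simpa using hv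
  have hs : Summable fun q : ℕ × ℕ × ℕ =>
      if q.1 + q.2.2 = q.2.1 + n then v q.1 * conj (v q.2.1) * v q.2.2 else 0 := by
    refine Summable.of_norm_bounded (hv.mul_norm (hcv.mul_norm hv)) fun q => ?_
    split_ifs
    · rw [mul_assoc]
    · rw [norm_zero]; exact norm_nonneg _
  rw [cubic, hs.tsum_prod, ← hφ, ← ha.tsum_eq]
  refine tsum_congr fun a => ?_
  rw [(hs.prod_factor a).tsum_prod, ← (hb a).tsum_eq, ← tsum_mul_left]
  refine tsum_congr fun b => ?_
  rw [← (hc a b).tsum_eq, ← tsum_mul_left, ← tsum_mul_left]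
  refine tsum_congr fun c => ?_
  simp only [basisVec_apply]
  by_cases h : a + c = b + n
  · rw [if_pos h, if_pos (by omega)]; ring
  · rw [if_neg h, if_neg (by omega)]; ring

variable {σ α : ℝ}

theorem symVec_szegoField (hv : Summable fun n => ‖v n‖)
    (hF : Summable fun n => ‖szegoField α v n‖) :
    symVec (szegoField α v) =
      -I • (toepOp v (symVec v) + ((α : ℂ) * v 0) • basisVec 0) := by
  ext n
  rw [symVec_apply hF, szegoField, cubic_eq_toepOp hv]
  simp only [lp.coeFn_smul, lp.coeFn_add, Pi.smul_apply, Pi.add_apply, basisVec_apply, oneSeq,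
    smul_eq_mul]

theorem hankelOp_szegoField (hv : Summable fun n => ‖v n‖)
    (hF : Summable fun n => ‖szegoField α v n‖) :
    hankelOp (szegoField α v) =
      -I • (toepOp v * hankelOp v + hankelOp v * (star (backOp v) * backOp v)) := by
  refine Hardy.clm_ext fun l => ?_
  have h0 : (bshift ^ (l + 1)) (basisVec 0) = 0 := by rw [bshift_pow_basisVec, if_neg (by omega)]
  rw [hankelOp_basisVec hF, symVec_szegoField hv hF, map_smul, map_add, map_smul, h0, smul_zero,
    add_zero, bshift_pow_toepOp_symVec hv]
  rfl

/-- The square `K_v²` of the antilinear shifted Hankel operator, as a linear operator. -/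
def hankelSq (v : ℕ → ℂ) : Hardy →L[ℂ] Hardy := hankelOp v * star (hankelOp v)

theorem star_hankelSq (v : ℕ → ℂ) : star (hankelSq v) = hankelSq v := by simp [hankelSq]

theorem hankelSq_lax (hv : Summable fun n => ‖v n‖)
    (hF : Summable fun n => ‖szegoField α v n‖) :
    hankelOp (szegoField α v) * star (hankelOp v) + hankelOp v * star (hankelOp (szegoField α v)) =
      -I • (toepOp v * hankelSq v - hankelSq v * toepOp v) := by
  rw [hankelOp_szegoField hv hF, hankelSq]
  have hs : ∀ (c : ℂ) (A B : Hardy →L[ℂ] Hardy), (c • A) * B = c • (A * B) := fun _ _ _ => rfl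
  rw [star_smul]
  simp only [star_add, star_mul, star_star, star_toepOp, Complex.star_def, map_neg,
    conj_I, neg_neg, hs, mul_smul_comm, mul_add, add_mul, mul_assoc, smul_sub,
    smul_add, neg_smul, neg_mul]
  abel

variable {u : ℝ → ℕ → ℂ}

theorem SolvesSzego.hasDerivAt_symVec (hsol : SolvesSzego α u) (h0 : 1 / 2 < σ) (h1 : σ ≤ 1)
    (hfin : ∀ t, FinWnorm σ (u t)) (t : ℝ) :
    HasDerivAt (fun τ => symVec (u τ))
      (-I • (toepOp (u t) (symVec (u t)) + ((α : ℂ) * u t 0) • basisVec 0)) t := by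
  rw [← symVec_szegoField ((hfin t).summable_norm h0)
    ((hfin t).summable_norm_szegoField h0 h1 α)]
  exact hsol.hasDerivAt_tsum_smul h0 h1 hfin (fun n => (norm_basisVec n).le) t

theorem SolvesSzego.hasDerivAt_hankelSq (hsol : SolvesSzego α u) (h0 : 1 / 2 < σ) (h1 : σ ≤ 1)
    (hfin : ∀ t, FinWnorm σ (u t)) (t : ℝ) :
    HasDerivAt (fun τ => hankelSq (u τ))
      (-I • (toepOp (u t) * hankelSq (u t) - hankelSq (u t) * toepOp (u t))) t := by
  rw [← hankelSq_lax ((hfin t).summable_norm h0) ((hfin t).summable_norm_szegoField h0 h1 α)]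
  have h := hsol.hasDerivAt_tsum_smul h0 h1 hfin norm_antidiag_le t
  have : StarModule ℝ (Hardy →L[ℂ] Hardy) := StarModule.complexToReal
  exact HasDerivAt.mul (𝔸 := Hardy →L[ℂ] Hardy) h h.star

theorem SolvesSzego.hasDerivAt_hankelSq_pow (hsol : SolvesSzego α u) (h0 : 1 / 2 < σ) (h1 : σ ≤ 1)
    (hfin : ∀ t, FinWnorm σ (u t)) (n : ℕ) (t : ℝ) :
    HasDerivAt (fun τ => hankelSq (u τ) ^ n)
      (-I • (toepOp (u t) * hankelSq (u t) ^ n - hankelSq (u t) ^ n * toepOp (u t))) t := by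
  induction n with
  | zero => simpa using hasDerivAt_const t (1 : Hardy →L[ℂ] Hardy)
  | succ n ih =>
    have h := HasDerivAt.mul (𝔸 := Hardy →L[ℂ] Hardy) ih
      (hsol.hasDerivAt_hankelSq h0 h1 hfin t)
    have hs : ∀ (c : ℂ) (A B : Hardy →L[ℂ] Hardy), (c • A) * B = c • (A * B) := fun _ _ _ => rfl
    have hp : (fun τ => hankelSq (u τ) ^ (n + 1)) =
        fun τ => hankelSq (u τ) ^ n * hankelSq (u τ) := funext fun _ => pow_succ _ _
    rw [hp, pow_succ]
    refine h.congr_deriv ?_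
    simp only [hs, mul_smul_comm, mul_sub, sub_mul, mul_assoc, ← smul_add]
    congr 1
    abel

/-- The moments conserved by the flow. -/
def moment (α : ℝ) (v : ℕ → ℂ) (n : ℕ) : ℂ :=
  inner ℂ (symVec v) ((hankelSq v ^ n) (symVec v)) -
    α * inner ℂ (basisVec 0) ((hankelSq v ^ n) (basisVec 0))

theorem HasDerivAt.clm_apply_hardy {A : ℝ → Hardy →L[ℂ] Hardy} {A' : Hardy →L[ℂ] Hardy}
    {x : ℝ → Hardy} {x' : Hardy} {t : ℝ} (hA : HasDerivAt A A' t) (hx : HasDerivAt x x' t) :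
    HasDerivAt (fun τ => A τ (x τ)) (A' (x t) + A t x') t := by
  have h := ((ContinuousLinearMap.apply ℂ Hardy : _ →L[ℂ] _).flip.bilinearRestrictScalars ℝ).hasFDerivAt_of_bilinear hA.hasFDerivAt hx.hasFDerivAt
  refine h.hasDerivAt.congr_deriv ?_
  rw [add_comm (A' (x t))]
  change A t ((1 : ℝ) • x') + ((1 : ℝ) • A') (x t) = _
  rw [one_smul, one_smul]

theorem SolvesSzego.hasDerivAt_moment (hsol : SolvesSzego α u) (h0 : 1 / 2 < σ) (h1 : σ ≤ 1)
    (hfin : ∀ t, FinWnorm σ (u t)) (n : ℕ) (t : ℝ) :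
    HasDerivAt (fun τ => moment α (u τ) n) 0 t := by
  have hX := hsol.hasDerivAt_hankelSq_pow h0 h1 hfin n t
  have hV := hsol.hasDerivAt_symVec h0 h1 hfin t
  have hE : HasDerivAt (fun _ : ℝ => basisVec 0) 0 t := hasDerivAt_const t _
  have hm := (hV.inner ℂ (hX.clm_apply_hardy hV)).sub
    ((hE.inner ℂ (hX.clm_apply_hardy hE)).const_mul (α : ℂ))
  refine hm.congr_deriv ?_
  have hv := (hfin t).summable_norm h0
  have hT : ∀ x y, inner ℂ x (toepOp (u t) y) = inner ℂ (toepOp (u t) x) y := fun x y => by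
    rw [← ContinuousLinearMap.adjoint_inner_left, ← ContinuousLinearMap.star_eq_adjoint,
      star_toepOp]
  have hXs : ∀ x y, inner ℂ (hankelSq (u t) x) y = inner ℂ x (hankelSq (u t) y) := fun x y => by
    rw [← ContinuousLinearMap.adjoint_inner_right, ← ContinuousLinearMap.star_eq_adjoint,
      star_hankelSq]
  have hX1 : (hankelSq (u t) ^ n) (hankelSq (u t) (basisVec 0)) =
      hankelSq (u t) ((hankelSq (u t) ^ n) (basisVec 0)) := by
    rw [← mul_apply_eq_comp, ← mul_apply_eq_comp, ← pow_succ, ← pow_succ']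
  have hTe : toepOp (u t) (basisVec 0) =
      hankelSq (u t) (basisVec 0) + conj (u t 0) • symVec (u t) := toepOp_basisVec_zero hv
  simp only [smul_apply, sub_apply, mul_apply_eq_comp,
    map_smul, map_add, inner_add_left, inner_add_right, inner_sub_right, inner_smul_left,
    inner_smul_right, hT, map_zero, inner_zero_left, add_zero, hTe, hX1, hXs, map_neg, map_mul,
    conj_I, conj_ofReal, conj_conj]
  ring

theorem SolvesSzego.moment_eq (hsol : SolvesSzego α u) (h0 : 1 / 2 < σ) (h1 : σ ≤ 1)
    (hfin : ∀ t, FinWnorm σ (u t)) (n : ℕ) (t₁ t₂ : ℝ) :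
    moment α (u t₁) n = moment α (u t₂) n :=
  is_const_of_deriv_eq_zero (fun t => (hsol.hasDerivAt_moment h0 h1 hfin n t).differentiableAt)
    (fun t => (hsol.hasDerivAt_moment h0 h1 hfin n t).deriv) t₁ t₂

end LaxPair

section Spectral

variable {H : Type*} [NormedAddCommGroup H] [InnerProductSpace ℂ H] [CompleteSpace H]

/-- Every vector is the sum of its components in the eigenspaces, indexed by the real line, of a
compact self-adjoint operator. -/
theorem exists_hasSum_eigenvectors {X : H →L[ℂ] H} (hX : IsCompactOperator X)
    (hs : (X : H →ₗ[ℂ] H).IsSymmetric) (v : H) :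
    ∃ w : ℝ → H, (∀ x : ℝ, X (w x) = (x : ℂ) • w x) ∧
      (∀ x y, x ≠ y → inner ℂ (w x) (w y) = 0) ∧ HasSum w v := by
  set F : ℝ → Submodule ℂ H := fun x => Module.End.eigenspace (X : Module.End ℂ H) (x : ℂ) with hF
  have hF' : ∀ x h, h ∈ F x ↔ X h = (x : ℂ) • h := fun x h => Module.End.mem_eigenspace_iff
  have hc : ∀ x, CompleteSpace (F x) := fun x => by
    have : IsClosed {h | X h = (x : ℂ) • h} := isClosed_eq X.continuous (continuous_const_smul _)
    refine IsClosed.completeSpace_coe (s := (F x : Set H)) (hs := ?_)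
    convert this using 1
    ext h
    exact hF' x h
  have ho : OrthogonalFamily ℂ (fun x => F x) fun x => (F x).subtypeₗᵢ :=
    hs.orthogonalFamily_eigenspaces.comp Complex.ofReal_injective
  have ht : ⊤ ≤ (⨆ x, F x).topologicalClosure := by
    rw [top_le_iff, Submodule.topologicalClosure_eq_top_iff, eq_bot_iff,
      ← ContinuousLinearMap.orthogonalComplement_iSup_eigenspaces_eq_bot hX hs]
    refine Submodule.orthogonal_le (iSup_le fun μ => ?_)
    by_cases hμ : Module.End.HasEigenvalue (X : Module.End ℂ H) μ
    · have h1 := Complex.conj_eq_iff_re.1 (hs.conj_eigenvalue_eq_self hμ)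
      rw [← h1]
      exact le_iSup F μ.re
    · rw [Module.End.hasEigenvalue_iff, not_not] at hμ
      rw [hμ]
      exact bot_le
  have hH := IsHilbertSum.mkInternal F ho ht
  refine ⟨fun x => hH.linearIsometryEquiv v x, fun x => (hF' x _).1 (Subtype.coe_prop _),
    fun x y hxy => ho hxy _ _, ?_⟩
  simpa using hH.hasSum_linearIsometryEquiv_symm (hH.linearIsometryEquiv v)

/-- The spectral measure of a vector with respect to a compact self-adjoint operator, as a weight
on the real line. -/
theorem exists_spectral_weight {X : H →L[ℂ] H} (hX : IsCompactOperator X)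
    (hs : (X : H →ₗ[ℂ] H).IsSymmetric) (v : H) :
    ∃ w : ℝ → ℂ, (∀ x, ‖X‖ < |x| → w x = 0) ∧ ∀ (A : H →L[ℂ] H) (f : ℝ → ℂ),
      (∀ (x : ℝ) h, X h = (x : ℂ) • h → A h = f x • h) →
        HasSum (fun x => f x * w x) (inner ℂ v (A v)) := by
  obtain ⟨w, hw, ho, hsum⟩ := exists_hasSum_eigenvectors hX hs v
  have hvw : ∀ x, inner ℂ v (w x) = inner ℂ (w x) (w x) := fun x => by
    have h1 := hsum.mapL (innerSL ℂ (w x))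
    have h2 := hasSum_single (f := fun y => innerSL ℂ (w x) (w y)) x fun y hy => ho x y hy.symm
    have h3 : inner ℂ (w x) v = inner ℂ (w x) (w x) := h1.unique h2
    rw [← inner_conj_symm, h3, inner_conj_symm]
  refine ⟨fun x => inner ℂ (w x) (w x), fun x hx => ?_, fun A f hA => ?_⟩
  · rw [inner_self_eq_zero]
    by_contra h
    have h1 := X.le_opNorm (w x)
    rw [hw, norm_smul, Complex.norm_real, Real.norm_eq_abs] at h1
    exact absurd (le_of_mul_le_mul_right h1 (norm_pos_iff.2 h)) (not_le.2 hx)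
  · have h1 := (hsum.mapL A).mapL (innerSL ℂ v)
    refine h1.congr_fun fun x => ?_
    rw [innerSL_apply_apply, hA x _ (hw x), inner_smul_right, hvw]

theorem tendsto_tsum_one_sub_sq_pow {c : ℝ → ℂ} (hc : Summable c) {N R x₀ : ℝ}
    (hN : ∀ x, N < |x| → c x = 0) (hR : N + |x₀| < R) (hN0 : 0 ≤ N) :
    Tendsto (fun k : ℕ => ∑' x, (1 - ((R : ℂ)⁻¹ * (x - x₀)) ^ 2) ^ k * c x) atTop (𝓝 (c x₀)) := by
  have hR0 : 0 < R := (add_nonneg hN0 (abs_nonneg _)).trans_lt hR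
  have hb : ∀ x : ℝ, c x ≠ 0 → |R⁻¹ * (x - x₀)| < 1 := fun x hx => by
    have h1 : |x| ≤ N := not_lt.1 fun h => hx (hN x h)
    rw [abs_mul, abs_of_pos (inv_pos.2 hR0), inv_mul_lt_iff₀ hR0, mul_one]
    exact (abs_sub _ _).trans_lt ((add_le_add_left h1 _).trans_lt hR)
  have hcast : ∀ x : ℝ, (1 - ((R : ℂ)⁻¹ * (x - x₀)) ^ 2 : ℂ) =
      ((1 - (R⁻¹ * (x - x₀)) ^ 2 : ℝ) : ℂ) := fun x => by push_cast; rfl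
  have hlim : ∑' x, (if x = x₀ then c x₀ else 0) = c x₀ := tsum_ite_eq _ _
  rw [← hlim]
  refine tendsto_tsum_of_dominated_convergence (bound := fun x => ‖c x‖) hc.norm (fun x => ?_)
    (Eventually.of_forall fun k x => ?_)
  · by_cases hx : x = x₀
    · simp [hx]
    rw [if_neg hx]
    by_cases h0 : c x = 0
    · simp [h0]
    have h1 := (sq_lt_one_iff_abs_lt_one _).2 (hb x h0)
    have h2 : 0 < (R⁻¹ * (x - x₀)) ^ 2 := by
      have : R⁻¹ * (x - x₀) ≠ 0 := mul_ne_zero (inv_pos.2 hR0).ne' (sub_ne_zero.2 hx)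
      positivity
    rw [hcast, ← zero_mul (c x)]
    refine (tendsto_pow_atTop_nhds_zero_of_norm_lt_one ?_).mul_const _
    rw [Complex.norm_real, Real.norm_eq_abs, abs_lt]
    constructor <;> linarith
  · by_cases h0 : c x = 0
    · simp [h0]
    have h1 := (sq_lt_one_iff_abs_lt_one _).2 (hb x h0)
    rw [norm_mul, hcast]
    refine mul_le_of_le_one_left (norm_nonneg _) ?_
    rw [norm_pow]
    refine pow_le_one₀ (norm_nonneg _) ?_
    rw [Complex.norm_real, Real.norm_eq_abs, abs_le]
    constructor <;> linarith [sq_nonneg (R⁻¹ * (x - x₀))]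

theorem pow_apply_of_apply_eq_smul {E : Type*} [NormedAddCommGroup E] [NormedSpace ℂ E]
    {X : E →L[ℂ] E} {z : ℂ} {h : E} (hz : X h = z • h) (n : ℕ) :
    (X ^ n) h = z ^ n • h := by
  induction n with
  | zero => simp
  | succ n ih => rw [pow_succ, mul_apply_eq_comp, hz, map_smul, ih, smul_smul, pow_succ']

/-- Functions of a compact self-adjoint operator are determined, in the weak sense, by the
moments: two signed combinations of spectral measures with the same moments coincide. -/
theorem inner_sub_inner_eq_of_moments_eq {X Y : H →L[ℂ] H} (hX : IsCompactOperator X)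
    (hXs : (X : H →ₗ[ℂ] H).IsSymmetric) (hY : IsCompactOperator Y)
    (hYs : (Y : H →ₗ[ℂ] H).IsSymmetric) {a : ℂ} {v w e : H}
    (hm : ∀ n : ℕ, inner ℂ v ((X ^ n) v) - a * inner ℂ e ((X ^ n) e) =
      inner ℂ w ((Y ^ n) w) - a * inner ℂ e ((Y ^ n) e))
    {A B : H →L[ℂ] H} {f : ℝ → ℂ} (hA : ∀ (x : ℝ) h, X h = (x : ℂ) • h → A h = f x • h)
    (hB : ∀ (x : ℝ) h, Y h = (x : ℂ) • h → B h = f x • h) :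
    inner ℂ v (A v) - a * inner ℂ e (A e) = inner ℂ w (B w) - a * inner ℂ e (B e) := by
  have key : ∀ {X : H →L[ℂ] H} {v : H}, IsCompactOperator X → (X : H →ₗ[ℂ] H).IsSymmetric →
      ∃ c : ℝ → ℂ, (∀ x, ‖X‖ < |x| → c x = 0) ∧ ∀ (A : H →L[ℂ] H) (f : ℝ → ℂ),
      (∀ (x : ℝ) h, X h = (x : ℂ) • h → A h = f x • h) →
        HasSum (fun x => f x * c x) (inner ℂ v (A v) - a * inner ℂ e (A e)) := by
    intro X v hX hXs
    obtain ⟨p, hp, hp'⟩ := exists_spectral_weight hX hXs v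
    obtain ⟨q, hq, hq'⟩ := exists_spectral_weight hX hXs e
    refine ⟨fun x => p x - a * q x, fun x hx => by simp [hp x hx, hq x hx], fun A f hA => ?_⟩
    refine ((hp' A f hA).sub ((hq' A f hA).mul_left a)).congr_fun fun x => ?_
    ring
  have hpoly : ∀ (X : H →L[ℂ] H) (p : Polynomial ℂ) (x : ℝ) h, X h = (x : ℂ) • h →
      Polynomial.aeval X p h = p.eval (x : ℂ) • h := fun X p x h hx => by
    rw [Polynomial.aeval_eq_sum_range, Polynomial.eval_eq_sum_range, sum_apply, Finset.sum_smul]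
    refine Finset.sum_congr rfl fun n _ => ?_
    rw [smul_apply, pow_apply_of_apply_eq_smul hx, smul_smul]
  obtain ⟨c, hc, hc'⟩ := key (v := v) hX hXs
  obtain ⟨d, hd, hd'⟩ := key (v := w) hY hYs
  have hp : ∀ p : Polynomial ℂ,
      ∑' x : ℝ, p.eval (x : ℂ) * c x = ∑' x : ℝ, p.eval (x : ℂ) * d x := fun p => by
    rw [(hc' _ _ (hpoly X p)).tsum_eq, (hd' _ _ (hpoly Y p)).tsum_eq]
    simp only [Polynomial.aeval_eq_sum_range, sum_apply, smul_apply, inner_sum, inner_smul_right,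
      Finset.mul_sum, ← Finset.sum_sub_distrib, mul_left_comm a, ← mul_sub, hm]
  have hcs : Summable c := by simpa using (hc' 1 (fun _ => 1) (by simp)).summable
  have hds : Summable d := by simpa using (hd' 1 (fun _ => 1) (by simp)).summable
  have hcd : c = d := by
    funext x₀
    set N := max ‖X‖ ‖Y‖
    have hN : 0 ≤ N := (norm_nonneg X).trans (le_max_left _ _)
    have h1 := tendsto_tsum_one_sub_sq_pow hcs (N := N) (x₀ := x₀)
      (fun x hx => hc x ((le_max_left _ _).trans_lt hx)) (lt_add_one _) hN
    have h2 := tendsto_tsum_one_sub_sq_pow hds (N := N) (x₀ := x₀)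
      (fun x hx => hd x ((le_max_right _ _).trans_lt hx)) (lt_add_one _) hN
    refine tendsto_nhds_unique h1 (h2.congr fun k => ?_)
    have := hp ((1 - (Polynomial.C ((N + |x₀| + 1 : ℝ) : ℂ)⁻¹ *
      (Polynomial.X - Polynomial.C (x₀ : ℂ))) ^ 2) ^ k)
    simpa using this.symm
  exact (hcd ▸ hc' A f hA).unique (hd' B f hB)

end Spectral

section Conservation

variable {v : ℕ → ℂ}

theorem isCompactOperator_hankelOp (hv : Summable fun n => ‖v n‖) :
    IsCompactOperator (hankelOp v) :=
  isCompactOperator_of_tendsto (hasSum_hankelOp hv).tendsto_sum_nat <| Eventually.of_forall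
    fun _ => Finset.sum_induction _ (fun A : Hardy →L[ℂ] Hardy => IsCompactOperator A)
      (fun _ _ => IsCompactOperator.add) isCompactOperator_zero
      fun n _ => (isCompactOperator_antidiag n).smul (v n)

theorem isCompactOperator_hankelSq (hv : Summable fun n => ‖v n‖) :
    IsCompactOperator (hankelSq v) :=
  (isCompactOperator_hankelOp hv).comp_clm (star (hankelOp v))

theorem isSymmetric_hankelSq (v : ℕ → ℂ) :
    ((hankelSq v : Hardy →L[ℂ] Hardy) : Hardy →ₗ[ℂ] Hardy).IsSymmetric :=
  ContinuousLinearMap.isSelfAdjoint_iff_isSymmetric.1 (star_hankelSq v)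

theorem hinner_eq_inner (x y : Hardy) : hinner x y = inner ℂ y x := by
  rw [lp.inner_eq_tsum, hinner]
  rfl

theorem star_hankelOp_apply (hv : Summable fun n => ‖v n‖) (x : Hardy) (l : ℕ) :
    star (hankelOp v) x l = conj (khankel v x l) := by
  rw [← inner_basisVec_left, ContinuousLinearMap.star_eq_adjoint,
    ContinuousLinearMap.adjoint_inner_right, hankelOp_basisVec hv, ← hinner_eq_inner, hinner,
    khankel, Complex.conj_tsum]
  refine tsum_congr fun m => ?_
  rw [bshift_pow_apply, symVec_apply hv, map_mul, conj_conj, mul_comm,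
    show m + (l + 1) = l + 1 + m by omega]

theorem hankelOp_apply (hv : Summable fun n => ‖v n‖) (x : Hardy) (k : ℕ) :
    hankelOp v x k = ∑' l, v (k + 1 + l) * x l := by
  have h := (x.hasSum_basisVec.mapL (hankelOp v)).mapL (innerSL ℂ (basisVec k))
  rw [innerSL_apply_apply, inner_basisVec_left] at h
  rw [← h.tsum_eq]
  refine tsum_congr fun l => ?_
  rw [map_smul, map_smul, innerSL_apply_apply, inner_basisVec_left, hankelOp_basisVec hv,
    bshift_pow_apply, symVec_apply hv, smul_eq_mul, mul_comm,
    show k + (l + 1) = k + 1 + l by omega]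

theorem ku2_eq_hankelSq (hv : Summable fun n => ‖v n‖) (x : Hardy) (k : ℕ) :
    ku2 v x k = hankelSq v x k := by
  rw [hankelSq, mul_apply_eq_comp, hankelOp_apply hv, ku2, khankel]
  simp only [star_hankelOp_apply hv]

end Conservation

/-- For every bounded Borel function `f` on ℝ, the quantity
`L_f(u) = (f(K_u²)u | u) − α (f(K_u²)1 | 1)` is conserved by the α-Szegő flow.
The operator `f(K_{u(t)}²)` is encoded as a bounded operator `A t` acting as
multiplication by `f(lam)` on each eigenspace `ker(K_{u(t)}² − lam)`. -/
theorem alphaSzego_conservation_borel (α s : ℝ) (hs : 1/2 < s) (u : ℝ → ℕ → ℂ)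
    (hreg : SmoothHsCurve s u) (hsol : SolvesSzego α u)
    (humem : ∀ t, Memℓp (u t) 2)
    (f : ℝ → ℝ) (hf : Measurable f) (hfb : ∃ C : ℝ, ∀ x : ℝ, |f x| ≤ C)
    (A : ℝ → Hardy →L[ℂ] Hardy)
    (hA : ∀ (t lam : ℝ) (h : Hardy),
      (∀ k, ku2 (u t) (⇑h) k = (lam : ℂ) * h k) → A t h = ((f lam : ℝ) : ℂ) • h) :
    ∀ t₁ t₂ : ℝ,
      hinner (⇑(A t₁ ⟨u t₁, humem t₁⟩)) (u t₁) - (α : ℂ) * hinner (⇑(A t₁ oneH)) oneSeq =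
      hinner (⇑(A t₂ ⟨u t₂, humem t₂⟩)) (u t₂) - (α : ℂ) * hinner (⇑(A t₂ oneH)) oneSeq := by
  have h0 : 1 / 2 < min s 1 := lt_min hs (by norm_num)
  have h1 : min s 1 ≤ 1 := min_le_right _ _
  have hfin : ∀ t, FinWnorm (min s 1) (u t) := fun t =>
    (hreg.1 t).finWnorm (by linarith) h1 (min_le_left _ _)
  have hv : ∀ t, Summable fun n => ‖u t n‖ := fun t => (hfin t).summable_norm h0
  have hone : ∀ x : Hardy, hinner x oneSeq = inner ℂ (basisVec 0) x := fun x => by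
    rw [← hinner_eq_inner]
    congr 1
    funext n
    rw [basisVec_apply, oneSeq]
  have hV : ∀ t, (⟨u t, humem t⟩ : Hardy) = symVec (u t) := fun t => by
    ext n
    exact (symVec_apply (hv t) n).symm
  have hL : ∀ t, hinner (⇑(A t ⟨u t, humem t⟩)) (u t) - (α : ℂ) * hinner (⇑(A t oneH)) oneSeq =
      inner ℂ (symVec (u t)) (A t (symVec (u t))) -
        α * inner ℂ (basisVec 0) (A t (basisVec 0)) := fun t => by
    rw [hone, ← hV, ← hinner_eq_inner]
    rfl
  have hAX : ∀ t (x : ℝ) h, hankelSq (u t) h = (x : ℂ) • h → A t h = ((f x : ℝ) : ℂ) • h :=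
    fun t x h hx => hA t x h fun k => by
      rw [ku2_eq_hankelSq (hv t), hx]
      rfl
  intro t₁ t₂
  rw [hL, hL]
  exact inner_sub_inner_eq_of_moments_eq (isCompactOperator_hankelSq (hv t₁))
    (isSymmetric_hankelSq _) (isCompactOperator_hankelSq (hv t₂)) (isSymmetric_hankelSq _)
    (fun n => hsol.moment_eq h0 h1 hfin n t₁ t₂) (hAX t₁) (hAX t₂)

end
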